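/- arXiv:1707.07919 — 8 statements merged into one kernel-verified Lean document; each statement's English description precedes it below -/
import Mathlib

section
/- In the single-location model, suppose κ satisfies 0 ≤ κ ≤ β·λ, V_sw ≥ 0, and (V, V_st) is a value-function pair for (ξ, κ, V_sw) with V ≥ 0 and V_st ≥ 0. Then for every z ∈ Z and every n ≥ 1: V_st(z,n) ≥ F(z,n)/(n + β + Ψ), where Ψ = (1/λ)·max_{z∈Z} ∑_{y≠z} μ(z,y). -/
open scoped BigOperators

variable {Z : Type}

/-- A Markovian strategy `ξ : S → [0,1]` on the state space `S = Z × ℕ`. -/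
def IsStrategy (ξ : Z → ℕ → ℝ) : Prop := ∀ z n, 0 ≤ ξ z n ∧ ξ z n ≤ 1

/-- The balance (stationarity) equations for the single-location chain `MC(ξ, κ)`. -/
def Balance [Fintype Z] [DecidableEq Z] (μ : Z → Z → ℝ) (lam γ κ : ℝ)
    (ξ : Z → ℕ → ℝ) (π : Z → ℕ → ℝ) : Prop :=
  ∀ x : Z, ∀ m : ℕ,
    π x m * ((∑ y ∈ Finset.univ.filter (fun y => y ≠ x), μ x y) + κ
        + lam * m * (1 - γ * ξ x m))
      = (∑ z ∈ Finset.univ.filter (fun z => z ≠ x), π z m * μ z x)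
        + κ * (if 1 ≤ m then π x (m - 1) else 0)
        + lam * (m + 1) * (1 - γ * ξ x (m + 1)) * π x (m + 1)

/-- A probability solution of the balance equations for `(ξ, κ)`. -/
def IsProbSolution [Fintype Z] [DecidableEq Z] (μ : Z → Z → ℝ) (lam γ κ : ℝ)
    (ξ : Z → ℕ → ℝ) (π : Z → ℕ → ℝ) : Prop :=
  (∀ z n, 0 ≤ π z n) ∧ Summable (fun p : Z × ℕ => π p.1 p.2) ∧
    (∑' p : Z × ℕ, π p.1 p.2) = 1 ∧ Balance μ lam γ κ ξ π

/-- A resource-sharing function: nonnegative, positive somewhere (with `n ≥ 1`),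
and tending to `0` as the number of agents grows. -/
def IsResourceSharing (F : Z → ℕ → ℝ) : Prop :=
  (∀ z n, 0 ≤ F z n) ∧ (∃ z₀ n₀, 1 ≤ n₀ ∧ 0 < F z₀ n₀) ∧
    ∀ z, Filter.Tendsto (fun n => F z n) Filter.atTop (nhds 0)

/-- A value-function pair `(V, V_st)` for `(ξ, κ, V_sw)`: the Bellman equations. -/
def IsValuePair [Fintype Z] [DecidableEq Z] (μ : Z → Z → ℝ) (lam γ κ V_sw : ℝ)
    (F ξ : Z → ℕ → ℝ) (V V_st : Z → ℕ → ℝ) : Prop :=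
  (∃ M, ∀ z n, |V z n| ≤ M) ∧ (∃ M, ∀ z n, |V_st z n| ≤ M) ∧
    ∀ z : Z, ∀ n : ℕ, 1 ≤ n →
      V z n = F z n + γ * max (V_st z n) V_sw ∧
      ((n : ℝ) * lam + κ + ∑ y ∈ Finset.univ.filter (fun y => y ≠ z), μ z y) * V_st z n
        = lam * V z n + κ * V_st z (n + 1)
          + (∑ w ∈ Finset.univ.filter (fun w => w ≠ z), μ z w * V_st w n)
          + ((n : ℝ) - 1) * lam * (1 - γ * ξ z n) * V_st z (n - 1)
          + ((n : ℝ) - 1) * lam * γ * ξ z n * V_st z n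

/-- A mean field equilibrium `(ξ, κ, V_sw, π, V, V_st)`. -/
def IsMFE [Fintype Z] [DecidableEq Z] (μ : Z → Z → ℝ) (lam γ β : ℝ) (F : Z → ℕ → ℝ)
    (ξ : Z → ℕ → ℝ) (κ V_sw : ℝ) (π V V_st : Z → ℕ → ℝ) : Prop :=
  IsStrategy ξ ∧ 0 < κ ∧ 0 < V_sw ∧
    IsProbSolution μ lam γ κ ξ π ∧
    IsValuePair μ lam γ κ V_sw F ξ V V_st ∧
    (∀ z : Z, ∀ n : ℕ, 1 ≤ n →
      (V_sw < V_st z n → ξ z n = 1) ∧ (V_st z n < V_sw → ξ z n = 0)) ∧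
    V_sw = (∑' p : Z × ℕ, π p.1 p.2 * V_st p.1 (p.2 + 1)) ∧
    (∑' p : Z × ℕ, (p.2 : ℝ) * π p.1 p.2) = β

/-- `Ψ = (1/λ) · max_{z ∈ Z} ∑_{y ≠ z} μ(z,y)`. -/
noncomputable def Psi [Fintype Z] [DecidableEq Z] [Nonempty Z]
    (μ : Z → Z → ℝ) (lam : ℝ) : ℝ :=
  (1 / lam) * Finset.univ.sup' Finset.univ_nonempty
    (fun z : Z => ∑ y ∈ Finset.univ.filter (fun y => y ≠ z), μ z y)

/-- **Lower bound on the continuation value** (from Lemma 9 of the paper): for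
`0 ≤ κ ≤ βλ`, `V_sw ≥ 0` and a nonnegative value-function pair `(V, V_st)`,
one has `V_st(z,n) ≥ F(z,n)/(n + β + Ψ)` for every `z ∈ Z` and `n ≥ 1`. -/
theorem vst_lower_bound (Z : Type) [Fintype Z] [DecidableEq Z] [Nonempty Z]
    (μ : Z → Z → ℝ) (hμ : ∀ z y : Z, z ≠ y → 0 < μ z y)
    (lam γ β : ℝ) (hlam : 0 < lam) (hγ : γ ∈ Set.Ioo (0 : ℝ) 1) (hβ : 0 < β)
    (F : Z → ℕ → ℝ) (hF : IsResourceSharing F)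
    (ξ : Z → ℕ → ℝ) (hξ : IsStrategy ξ)
    (κ : ℝ) (hκ0 : 0 ≤ κ) (hκβ : κ ≤ β * lam)
    (V_sw : ℝ) (hVsw : 0 ≤ V_sw)
    (V V_st : Z → ℕ → ℝ) (hpair : IsValuePair μ lam γ κ V_sw F ξ V V_st)
    (hV : ∀ z n, 0 ≤ V z n) (hVst : ∀ z n, 0 ≤ V_st z n) :
    ∀ z : Z, ∀ n : ℕ, 1 ≤ n →
      F z n / ((n : ℝ) + β + Psi μ lam) ≤ V_st z n := by
  intro z n hn
  obtain ⟨-, -, h⟩ := hpair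
  obtain ⟨h1, h2⟩ := h z n hn
  have hn' : (1 : ℝ) ≤ n := by exact_mod_cast hn
  obtain ⟨hx0, hx1⟩ := hξ z n
  obtain ⟨hγ0, hγ1⟩ := hγ
  have hS0 : 0 ≤ ∑ y ∈ Finset.univ.filter (fun y => y ≠ z), μ z y :=
    Finset.sum_nonneg fun y hy => (hμ z y (Ne.symm (Finset.mem_filter.1 hy).2)).le
  have hSm : (∑ y ∈ Finset.univ.filter (fun y => y ≠ z), μ z y) ≤ lam * Psi μ lam := by
    unfold Psi
    rw [← mul_assoc, mul_one_div_cancel hlam.ne', one_mul]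
    exact Finset.le_sup' (fun z : Z => ∑ y ∈ Finset.univ.filter (fun y => y ≠ z), μ z y)
      (Finset.mem_univ z)
  have hT : 0 ≤ ∑ w ∈ Finset.univ.filter (fun w => w ≠ z), μ z w * V_st w n :=
    Finset.sum_nonneg fun y hy =>
      mul_nonneg (hμ z y (Ne.symm (Finset.mem_filter.1 hy).2)).le (hVst y n)
  have hPsi : 0 ≤ Psi μ lam := nonneg_of_mul_nonneg_right (hS0.trans hSm) hlam
  have ha : 0 ≤ κ * V_st z (n + 1) := mul_nonneg hκ0 (hVst _ _)
  have hg : 0 ≤ 1 - γ * ξ z n := by nlinarith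
  have hn1 : 0 ≤ (n : ℝ) - 1 := by linarith
  have hb : 0 ≤ ((n : ℝ) - 1) * lam * (1 - γ * ξ z n) * V_st z (n - 1) :=
    mul_nonneg (mul_nonneg (mul_nonneg hn1 hlam.le) hg) (hVst _ _)
  have hc : 0 ≤ ((n : ℝ) - 1) * lam * γ * ξ z n * V_st z n :=
    mul_nonneg (mul_nonneg (mul_nonneg (mul_nonneg hn1 hlam.le) hγ0.le) hx0) (hVst _ _)
  have hd : F z n ≤ V z n := by
    rw [h1]
    have := mul_nonneg hγ0.le (le_max_of_le_right hVsw : 0 ≤ max (V_st z n) V_sw)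
    linarith
  have he : lam * F z n ≤ lam * V z n := mul_le_mul_of_nonneg_left hd hlam.le
  have hf := mul_le_mul_of_nonneg_right
    (show (n : ℝ) * lam + κ + ∑ y ∈ Finset.univ.filter (fun y => y ≠ z), μ z y
      ≤ lam * ((n : ℝ) + β + Psi μ lam) by linarith) (hVst z n)
  rw [div_le_iff₀ (by linarith)]
  refine le_of_mul_le_mul_left ?_ hlam
  linarith
end

section
/- In the single-location model, let ξ be a Markovian strategy and κ an arrival rate with κ ≥ β·λ·(1−γ), and let π : S → [0,∞) satisfy the balance equations for (ξ,κ). Then for every z ∈ Z and every n ≥ 1: π(z,n) ≥ π(z,n−1) · β·(1−γ) / ((1 + β + Ψ)·n), and consequently π(z,n) ≥ π(z,0) · (β·(1−γ))ⁿ / ((1 + β + Ψ)ⁿ · n!), where Ψ = (1/λ)·max_{z∈Z} ∑_{y≠z} μ(z,y). -/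
open scoped BigOperators

variable {Z : Type}

/-- **Lower bound on the stationary distribution** (from Lemma 9 of the paper): if
`κ ≥ βλ(1-γ)` and `π ≥ 0` satisfies the balance equations for `(ξ, κ)`, then
`π(z,n) ≥ π(z,n-1)·β(1-γ)/((1+β+Ψ)·n)` and consequently
`π(z,n) ≥ π(z,0)·(β(1-γ))ⁿ/((1+β+Ψ)ⁿ·n!)`. -/
theorem pi_lower_bound (Z : Type) [Fintype Z] [DecidableEq Z] [Nonempty Z]
    (μ : Z → Z → ℝ) (hμ : ∀ z y : Z, z ≠ y → 0 < μ z y)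
    (lam γ β : ℝ) (hlam : 0 < lam) (hγ : γ ∈ Set.Ioo (0 : ℝ) 1) (hβ : 0 < β)
    (ξ : Z → ℕ → ℝ) (hξ : IsStrategy ξ)
    (κ : ℝ) (hκ : β * lam * (1 - γ) ≤ κ)
    (π : Z → ℕ → ℝ) (hπ0 : ∀ z n, 0 ≤ π z n)
    (hbal : Balance μ lam γ κ ξ π) :
    ∀ z : Z, ∀ n : ℕ, 1 ≤ n →
      π z (n - 1) * (β * (1 - γ)) / ((1 + β + Psi μ lam) * n) ≤ π z n ∧
      π z 0 * (β * (1 - γ)) ^ n / ((1 + β + Psi μ lam) ^ n * (n.factorial : ℝ)) ≤ π z n := by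
  have hg0 := hγ.1
  have hg1 := hγ.2
  have hM0 : ∀ x : Z, 0 ≤ ∑ y ∈ Finset.univ.filter (fun y => y ≠ x), μ x y := by
    intro x
    apply Finset.sum_nonneg
    intro y hy
    exact (hμ x y (Ne.symm (Finset.mem_filter.mp hy).2)).le
  have hMle : ∀ x : Z, ∑ y ∈ Finset.univ.filter (fun y => y ≠ x), μ x y
      ≤ lam * Psi μ lam := by
    intro x
    have h := Finset.le_sup' (fun z : Z => ∑ y ∈ Finset.univ.filter (fun y => y ≠ z), μ z y)
      (Finset.mem_univ x)
    unfold Psi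
    rw [← mul_assoc, mul_one_div_cancel hlam.ne', one_mul]
    exact h
  have hP0 : 0 ≤ Psi μ lam := by
    obtain ⟨x⟩ := (inferInstance : Nonempty Z)
    have h := (hM0 x).trans (hMle x)
    exact nonneg_of_mul_nonneg_right h hlam
  have hb0 : 0 < β * (1 - γ) := mul_pos hβ (by linarith)
  have hbβ : β * (1 - γ) ≤ β := by nlinarith
  have key : ∀ z : Z, ∀ n : ℕ, π z n * (β * (1 - γ)) / ((1 + β + Psi μ lam) * ((n + 1 : ℕ) : ℝ))
      ≤ π z (n + 1) := by
    intro z n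
    have hB := hbal z (n + 1)
    rw [if_pos (by omega), Nat.add_sub_cancel] at hB
    have hS : 0 ≤ ∑ w ∈ Finset.univ.filter (fun w => w ≠ z), π w (n + 1) * μ w z := by
      apply Finset.sum_nonneg
      intro y hy
      exact mul_nonneg (hπ0 _ _) (hμ y z (Finset.mem_filter.mp hy).2).le
    have hx1 := hξ z (n + 1)
    have hx2 := hξ z (n + 1 + 1)
    have hlast : 0 ≤ lam * (((n + 1 : ℕ) : ℝ) + 1) * (1 - γ * ξ z (n + 1 + 1))
        * π z (n + 1 + 1) := by
      have : 0 ≤ 1 - γ * ξ z (n + 1 + 1) := by nlinarith [hx2.1, hx2.2]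
      have := hπ0 z (n + 1 + 1)
      positivity
    have hN : (1 : ℝ) ≤ ((n + 1 : ℕ) : ℝ) := by
      push_cast
      linarith [(Nat.cast_nonneg n : (0 : ℝ) ≤ n)]
    have hp := hπ0 z (n + 1)
    have hM := hMle z
    generalize ((n + 1 : ℕ) : ℝ) = N at *
    generalize (∑ y ∈ Finset.univ.filter (fun y => y ≠ z), μ z y) = M at *
    generalize π z (n + 1) = p at *
    generalize π z n = q at *
    generalize Psi μ lam = P at *
    have hc : lam * N * (1 - γ * ξ z (n + 1)) ≤ lam * N := by
      have h1 : 0 ≤ γ * ξ z (n + 1) := mul_nonneg hg0.le hx1.1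
      have h2 : 0 < lam * N := by positivity
      nlinarith
    have hD : κ * q ≤ p * (lam * P + κ + lam * N) :=
      le_trans (by linarith) (mul_le_mul_of_nonneg_left (by linarith :
        M + κ + lam * N * (1 - γ * ξ z (n + 1)) ≤ lam * P + κ + lam * N) hp)
    rw [div_le_iff₀ (by positivity)]
    have hfin : P + N + β ≤ (1 + β + P) * N := by nlinarith
    have h3 := mul_le_mul_of_nonneg_left hfin hp
    have h4 := mul_le_mul_of_nonneg_left hbβ hp
    rcases le_total q p with hqp | hqp
    · have h5 := mul_le_mul_of_nonneg_right hqp hb0.le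
      have h6 : 0 ≤ p * (P + N) := by positivity
      linarith
    · have h5 := mul_le_mul_of_nonneg_right hκ (sub_nonneg.mpr hqp)
      have h6 : lam * (β * (1 - γ) * (q - p)) ≤ lam * (p * (P + N)) := by linarith
      have h7 := le_of_mul_le_mul_left h6 hlam
      linarith
  have key2 : ∀ z : Z, ∀ n : ℕ,
      π z 0 * (β * (1 - γ)) ^ n / ((1 + β + Psi μ lam) ^ n * (n.factorial : ℝ)) ≤ π z n := by
    intro z n
    induction n with
    | zero => simp
    | succ n ih =>
      refine le_trans ?_ (key z n)
      have hC : 0 < 1 + β + Psi μ lam := by linarith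
      have h : π z 0 * (β * (1 - γ)) ^ (n + 1)
          / ((1 + β + Psi μ lam) ^ (n + 1) * ((n + 1).factorial : ℝ))
          = (π z 0 * (β * (1 - γ)) ^ n / ((1 + β + Psi μ lam) ^ n * (n.factorial : ℝ)))
            * (β * (1 - γ)) / ((1 + β + Psi μ lam) * ((n + 1 : ℕ) : ℝ)) := by
        rw [Nat.factorial_succ, Nat.cast_mul, pow_succ, pow_succ, div_mul_eq_mul_div, div_div]
        congr 1 <;> ring
      rw [h]
      gcongr
  intro z n hn
  refine ⟨?_, key2 z n⟩
  obtain ⟨m, rfl⟩ : ∃ m, n = m + 1 := ⟨n - 1, by omega⟩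
  exact key z m
end

section
/- Let ξ be any Markovian strategy and κ an arrival rate with 0 ≤ κ ≤ β·λ, and let π be a probability solution of the balance equations for (ξ,κ). Then for every k ∈ ℕ: ∑_{z∈Z} ∑_{n>k} π(z,n) ≤ ∑_{n>k} e^{−β/(1−γ)}·(β/(1−γ))ⁿ/n!. In particular, the family of all probability solutions of the balance equations, over all Markovian strategies ξ and all κ ∈ [β·λ·(1−γ), β·λ], is uniformly tight. -/
open scoped BigOperators

variable {Z : Type}

lemma aux_compare (P q : ℕ → ℝ) (hP : HasSum P 1) (hq : HasSum q 1)
    (hcross : ∀ m n, m ≤ n → P n * q m ≤ P m * q n) (k : ℕ) :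
    ∑ i ∈ Finset.range (k+1), q i ≤ ∑ i ∈ Finset.range (k+1), P i := by
  have tP : HasSum (fun j => P (j + (k+1))) (1 - ∑ i ∈ Finset.range (k+1), P i) :=
    (hasSum_nat_add_iff' (k+1)).2 hP
  have tq : HasSum (fun j => q (j + (k+1))) (1 - ∑ i ∈ Finset.range (k+1), q i) :=
    (hasSum_nat_add_iff' (k+1)).2 hq
  have h1 : ∀ m ∈ Finset.range (k+1),
      (1 - ∑ i ∈ Finset.range (k+1), P i) * q m ≤ P m * (1 - ∑ i ∈ Finset.range (k+1), q i) := by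
    intro m hm
    have hm' := Finset.mem_range.1 hm
    exact hasSum_le (fun j => hcross m (j + (k+1)) (by omega)) (tP.mul_right (q m))
      (tq.mul_left (P m))
  have h2 := Finset.sum_le_sum h1
  rw [← Finset.mul_sum, ← Finset.sum_mul] at h2
  linarith

lemma aux_tail (P : ℕ → ℝ) (hP : HasSum P 1) (k : ℕ) :
    HasSum (fun n => if k < n then P n else 0) (1 - ∑ i ∈ Finset.range (k+1), P i) := by
  have h : HasSum (fun n => if n ∈ Finset.range (k+1) then P n else 0)
      (∑ i ∈ Finset.range (k+1), if i ∈ Finset.range (k+1) then P i else 0) :=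
    hasSum_sum_of_ne_finset_zero (fun b hb => by simp [hb])
  have h' : (∑ i ∈ Finset.range (k+1), if i ∈ Finset.range (k+1) then P i else 0)
      = ∑ i ∈ Finset.range (k+1), P i := Finset.sum_congr rfl (fun i hi => by simp [hi])
  rw [h'] at h
  suffices e : (fun n => if k < n then P n else 0)
      = fun n => P n - (if n ∈ Finset.range (k+1) then P n else 0) by
    rw [e]
    exact hP.sub h
  funext n
  by_cases hn : k < n
  · have : ¬ n < k + 1 := by omega
    simp [hn, this]
  · have : n < k + 1 := by omega
    simp [hn, this]

lemma aux_swap {Z : Type} [Fintype Z] (f : Z × ℕ → ℝ) (hf : Summable f) :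
    HasSum (fun n => ∑ z, f (z, n)) (∑' p, f p) := by
  have h : ∀ z, Summable (fun n => f (z, n)) := fun z => hf.prod_factor z
  have h1 : HasSum (fun n => ∑ z, f (z, n)) (∑ z, ∑' n, f (z, n)) :=
    hasSum_sum (fun z _ => (h z).hasSum)
  rwa [hf.tsum_prod' h, tsum_fintype]

lemma aux_mu {Z : Type} [Fintype Z] [DecidableEq Z] (μ : Z → Z → ℝ) (p : Z → ℝ) :
    ∑ x, p x * (∑ y ∈ Finset.univ.filter (fun y => y ≠ x), μ x y)
      = ∑ x, ∑ z ∈ Finset.univ.filter (fun z => z ≠ x), p z * μ z x := by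
  simp only [Finset.sum_filter, Finset.mul_sum]
  rw [Finset.sum_comm]
  refine Finset.sum_congr rfl fun x _ => Finset.sum_congr rfl fun y _ => ?_
  by_cases h : x = y
  · simp [h]
  · simp [h, Ne.symm h]

lemma aux_flux {Z : Type} [Fintype Z] [DecidableEq Z] (μ : Z → Z → ℝ) (lam γ κ : ℝ)
    (ξ π : Z → ℕ → ℝ) (hB : Balance μ lam γ κ ξ π) (m : ℕ) :
    ∑ x, lam * ((m : ℝ) + 1) * (1 - γ * ξ x (m + 1)) * π x (m + 1) = κ * ∑ x, π x m := by
  induction m with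
  | zero =>
    have h := Finset.sum_congr (rfl : (Finset.univ : Finset Z) = Finset.univ)
      (fun x _ => hB x 0)
    simp only [mul_add, Finset.sum_add_distrib, aux_mu μ (fun x => π x 0)] at h
    simp [← Finset.sum_mul] at h
    simp
    linarith
  | succ m ih =>
    have h := Finset.sum_congr (rfl : (Finset.univ : Finset Z) = Finset.univ)
      (fun x _ => hB x (m+1))
    have e : ∀ x, π x (m+1) * ((∑ y ∈ Finset.univ.filter (fun y => y ≠ x), μ x y) + κ
        + lam * ((m+1 : ℕ) : ℝ) * (1 - γ * ξ x (m+1)))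
        = π x (m+1) * (∑ y ∈ Finset.univ.filter (fun y => y ≠ x), μ x y) + κ * π x (m+1)
          + lam * ((m : ℝ) + 1) * (1 - γ * ξ x (m + 1)) * π x (m + 1) := by
      intro x; push_cast; ring
    simp only [e] at h
    rw [Finset.sum_add_distrib, Finset.sum_add_distrib, Finset.sum_add_distrib,
      Finset.sum_add_distrib, aux_mu μ (fun x => π x (m+1)), ih] at h
    simp [← Finset.mul_sum] at h
    simp only [Finset.mul_sum] at h ⊢
    push_cast
    linarith

lemma aux_poisson (a : ℝ) :
    HasSum (fun n : ℕ => Real.exp (-a) * a ^ n / (n.factorial : ℝ)) 1 := by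
  have h := (NormedSpace.expSeries_div_hasSum_exp (𝔸 := ℝ) a).mul_left (Real.exp (-a))
  rw [← Real.exp_eq_exp_ℝ, ← Real.exp_add] at h
  simpa [mul_div_assoc] using h

lemma aux_step {Z : Type} [Fintype Z] [DecidableEq Z] (μ : Z → Z → ℝ) (lam γ β κ : ℝ)
    (hlam : 0 < lam) (hγ : γ ∈ Set.Ioo (0 : ℝ) 1)
    (ξ π : Z → ℕ → ℝ) (hξ : IsStrategy ξ) (hκ : κ ≤ β * lam) (h0 : ∀ z n, 0 ≤ π z n)
    (hB : Balance μ lam γ κ ξ π) (m : ℕ) :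
    ((m : ℝ) + 1) * ∑ x, π x (m+1) ≤ β / (1 - γ) * ∑ x, π x m := by
  have hg : 0 < 1 - γ := by linarith [hγ.2]
  have h := aux_flux μ lam γ κ ξ π hB m
  have h1 : lam * ((m : ℝ) + 1) * (1 - γ) * ∑ x, π x (m+1)
      ≤ ∑ x, lam * ((m : ℝ) + 1) * (1 - γ * ξ x (m + 1)) * π x (m + 1) := by
    rw [Finset.mul_sum]
    refine Finset.sum_le_sum fun x _ => ?_
    refine mul_le_mul_of_nonneg_right (mul_le_mul_of_nonneg_left ?_ (by positivity)) (h0 _ _)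
    nlinarith [(hξ x (m+1)).2, hγ.1]
  have h2 : κ * ∑ x, π x m ≤ β * lam * ∑ x, π x m :=
    mul_le_mul_of_nonneg_right hκ (Finset.sum_nonneg fun x _ => h0 _ _)
  rw [div_mul_eq_mul_div, le_div_iff₀ hg]
  refine le_of_mul_le_mul_left ?_ hlam
  linarith

lemma aux_cross (a : ℝ) (ha : 0 < a) (P : ℕ → ℝ)
    (hs : ∀ m : ℕ, ((m : ℝ) + 1) * P (m+1) ≤ a * P m) (m n : ℕ) (hmn : m ≤ n) :
    P n * (Real.exp (-a) * a ^ m / (m.factorial : ℝ))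
      ≤ P m * (Real.exp (-a) * a ^ n / (n.factorial : ℝ)) := by
  have key : ∀ n : ℕ, m ≤ n → P n * ((n.factorial : ℝ) / a ^ n)
      ≤ P m * ((m.factorial : ℝ) / a ^ m) := by
    intro n hn
    induction n, hn using Nat.le_induction with
    | base => exact le_rfl
    | succ n hn ih =>
      refine le_trans ?_ ih
      have := mul_le_mul_of_nonneg_right (hs n)
        (show 0 ≤ (n.factorial : ℝ) / a ^ (n+1) by positivity)
      calc _ = ((n : ℝ) + 1) * P (n+1) * ((n.factorial : ℝ) / a ^ (n+1)) := by
            rw [Nat.factorial_succ]; push_cast; ring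
        _ ≤ _ := this
        _ = _ := by field_simp; ring
  have h := mul_le_mul_of_nonneg_right (key n hmn)
    (show 0 ≤ Real.exp (-a) * (a ^ m / (m.factorial : ℝ)) * (a ^ n / (n.factorial : ℝ)) by
      positivity)
  have hm : (m.factorial : ℝ) ≠ 0 := by positivity
  have hn : (n.factorial : ℝ) ≠ 0 := by positivity
  calc _ = P n * ((n.factorial : ℝ) / a ^ n) *
        (Real.exp (-a) * (a ^ m / (m.factorial : ℝ)) * (a ^ n / (n.factorial : ℝ))) := by
        field_simp
    _ ≤ _ := h
    _ = _ := by field_simp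

lemma aux_main {Z : Type} [Fintype Z] [DecidableEq Z] (μ : Z → Z → ℝ) (lam γ β κ : ℝ)
    (hlam : 0 < lam) (hγ : γ ∈ Set.Ioo (0 : ℝ) 1) (hβ : 0 < β)
    (ξ π : Z → ℕ → ℝ) (hξ : IsStrategy ξ) (hκ : κ ≤ β * lam)
    (hπ : IsProbSolution μ lam γ κ ξ π) (k : ℕ) :
    (∑' p : Z × ℕ, if k < p.2 then π p.1 p.2 else 0)
          ≤ 1 - ∑ n ∈ Finset.range (k+1),
              Real.exp (-(β / (1 - γ))) * (β / (1 - γ)) ^ n / (n.factorial : ℝ) := by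
  obtain ⟨h0, hsum, h1, hB⟩ := hπ
  have hg : 0 < 1 - γ := by linarith [hγ.2]
  have hP := aux_swap _ hsum
  rw [h1] at hP
  have hT : Summable (fun p : Z × ℕ => if k < p.2 then π p.1 p.2 else 0) :=
    Summable.of_nonneg_of_le (fun p => by split_ifs <;> simp [h0])
      (fun p => by split_ifs <;> simp [h0]) hsum
  have hT' := aux_swap _ hT
  have hT2 := aux_tail _ hP k
  have e : (fun n => ∑ z : Z, if k < n then π z n else 0)
      = fun n => if k < n then ∑ z : Z, π z n else 0 := by
    funext n; split_ifs <;> simp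
  simp only [e] at hT'
  rw [hT'.unique hT2]
  have := aux_compare _ _ hP (aux_poisson (β / (1 - γ)))
    (aux_cross _ (by positivity) _ (aux_step μ lam γ β κ hlam hγ ξ π hξ hκ h0 hB)) k
  linarith

/-- **Uniform tail bound and tightness** (Lemma 3 of the paper): the stationary
distribution of `MC(ξ,κ)` is stochastically dominated by the Poisson distribution
with mean `β/(1-γ)`, uniformly in `ξ` and `κ ≤ βλ`; in particular the family of
stationary distributions is uniformly tight. -/
theorem pi_tail_bound (Z : Type) [Fintype Z] [DecidableEq Z] [Nonempty Z]
    (μ : Z → Z → ℝ) (hμ : ∀ z y : Z, z ≠ y → 0 < μ z y)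
    (lam γ β : ℝ) (hlam : 0 < lam) (hγ : γ ∈ Set.Ioo (0 : ℝ) 1) (hβ : 0 < β) :
    (∀ (ξ : Z → ℕ → ℝ) (κ : ℝ) (π : Z → ℕ → ℝ), IsStrategy ξ →
      0 ≤ κ → κ ≤ β * lam → IsProbSolution μ lam γ κ ξ π →
      ∀ k : ℕ,
        (∑' p : Z × ℕ, if k < p.2 then π p.1 p.2 else 0)
          ≤ ∑' n : ℕ, if k < n then
              Real.exp (-(β / (1 - γ))) * (β / (1 - γ)) ^ n / (n.factorial : ℝ)
            else 0) ∧
    ∀ ε : ℝ, 0 < ε → ∃ k : ℕ,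
      ∀ (ξ : Z → ℕ → ℝ) (κ : ℝ) (π : Z → ℕ → ℝ), IsStrategy ξ →
        κ ∈ Set.Icc (β * lam * (1 - γ)) (β * lam) → IsProbSolution μ lam γ κ ξ π →
        (∑' p : Z × ℕ, if k < p.2 then π p.1 p.2 else 0) < ε := by
  refine ⟨fun ξ κ π hξ _ hκ hπ k => ?_, fun ε hε => ?_⟩
  · rw [(aux_tail _ (aux_poisson (β / (1 - γ))) k).tsum_eq]
    exact aux_main μ lam γ β κ hlam hγ hβ ξ π hξ hκ hπ k
  · have ht := (Filter.tendsto_add_atTop_iff_nat 1).2 (aux_poisson (β / (1 - γ))).tendsto_sum_nat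
    obtain ⟨k, hk⟩ := (ht.eventually (lt_mem_nhds (show 1 - ε < 1 by linarith))).exists
    refine ⟨k, fun ξ κ π hξ hκ hπ => ?_⟩
    have := aux_main μ lam γ β κ hlam hγ hβ ξ π hξ hκ.2 hπ k
    linarith
end

section
/- Let ξ be any Markovian strategy, κ ≥ 0 an arrival rate, and π a probability solution of the balance equations for (ξ,κ). Then the mean number of agents ∑_{(z,n)∈S} n·π(z,n) is finite and satisfies κ/λ ≤ ∑_{(z,n)∈S} n·π(z,n) ≤ κ/(λ·(1−γ)). -/
open scoped BigOperators

variable {Z : Type}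

theorem aux_summable {Z : Type} [Fintype Z] (f : Z → ℕ → ℝ) (hf : ∀ z n, 0 ≤ f z n)
    (h : Summable (fun n => ∑ z, f z n)) : Summable (fun p : Z × ℕ => f p.1 p.2) := by
  refine (summable_prod_of_nonneg (fun p => hf p.1 p.2)).2 ⟨fun z => ?_, ?_⟩
  · exact Summable.of_nonneg_of_le (fun n => hf z n)
      (fun n => Finset.single_le_sum (f := fun z => f z n) (fun z _ => hf z n)
        (Finset.mem_univ z)) h
  · exact Summable.of_finite

theorem aux_hasSum {Z : Type} [Fintype Z] (f : Z → ℕ → ℝ)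
    (h : Summable (fun p : Z × ℕ => f p.1 p.2)) :
    HasSum (fun n => ∑ z, f z n) (∑' p : Z × ℕ, f p.1 p.2) := by
  have h2 : HasSum (fun p : ℕ × Z => f p.2 p.1) (∑' p : Z × ℕ, f p.1 p.2) :=
    (Equiv.prodComm ℕ Z).hasSum_iff.2 h.hasSum
  exact h2.prod_fiberwise (fun n => hasSum_fintype _)

theorem aux_flow {Z : Type} [Fintype Z] [DecidableEq Z] (μ : Z → Z → ℝ) (lam γ κ : ℝ)
    (ξ π : Z → ℕ → ℝ) (h : Balance μ lam γ κ ξ π) (m : ℕ) :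
    ∑ x, lam * ((m : ℝ) + 1) * (1 - γ * ξ x (m + 1)) * π x (m + 1) = κ * ∑ x, π x m := by
  have hμ : ∀ m, ∑ x, ∑ y ∈ Finset.univ.filter (fun y => y ≠ x), π x m * μ x y
      = ∑ x, ∑ z ∈ Finset.univ.filter (fun z => z ≠ x), π z m * μ z x := by
    intro m
    simp only [Finset.sum_filter]
    rw [Finset.sum_comm]
    simp only [ne_comm]
  have key : ∀ m : ℕ, κ * ∑ x, π x m + ∑ x, lam * (m : ℝ) * (1 - γ * ξ x m) * π x m
      = κ * (∑ x, if 1 ≤ m then π x (m - 1) else 0)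
        + ∑ x, lam * ((m : ℝ) + 1) * (1 - γ * ξ x (m + 1)) * π x (m + 1) := by
    intro m
    have h1 := Finset.sum_congr (rfl : (Finset.univ : Finset Z) = Finset.univ)
      (fun x _ => h x m)
    simp only [mul_add, Finset.sum_add_distrib, Finset.mul_sum, hμ m] at h1
    simp only [Finset.mul_sum, mul_add, Finset.sum_add_distrib]
    have e1 : ∑ x, π x m * κ = ∑ x, κ * π x m := Finset.sum_congr rfl fun x _ => by ring
    have e2 : ∑ x, π x m * (lam * (m : ℝ) * (1 - γ * ξ x m))
      = ∑ x, lam * (m : ℝ) * (1 - γ * ξ x m) * π x m :=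
        Finset.sum_congr rfl fun x _ => by ring
    rw [e1, e2] at h1
    linarith
  induction m with
  | zero => have := key 0; simp at this ⊢; linarith
  | succ k ih =>
    have := key (k + 1)
    simp only [Nat.le_add_left, if_true, Nat.add_sub_cancel] at this
    push_cast at this ⊢
    linarith

/-- **Bounds on the mean number of agents** (Lemma 6 of the paper): for any
Markovian strategy `ξ` and arrival rate `κ ≥ 0`, the mean of any probability
solution of the balance equations is finite and lies between `κ/λ` and
`κ/(λ(1-γ))`. -/
theorem mean_agents_bounds (Z : Type) [Fintype Z] [DecidableEq Z] [Nonempty Z]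
    (μ : Z → Z → ℝ) (hμ : ∀ z y : Z, z ≠ y → 0 < μ z y)
    (lam γ : ℝ) (hlam : 0 < lam) (hγ : γ ∈ Set.Ioo (0 : ℝ) 1)
    (ξ : Z → ℕ → ℝ) (hξ : IsStrategy ξ)
    (κ : ℝ) (hκ : 0 ≤ κ)
    (π : Z → ℕ → ℝ) (hπ : IsProbSolution μ lam γ κ ξ π) :
    Summable (fun p : Z × ℕ => (p.2 : ℝ) * π p.1 p.2) ∧
    κ / lam ≤ (∑' p : Z × ℕ, (p.2 : ℝ) * π p.1 p.2) ∧
    (∑' p : Z × ℕ, (p.2 : ℝ) * π p.1 p.2) ≤ κ / (lam * (1 - γ)) := by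
  obtain ⟨h0, hs, h1, hb⟩ := hπ
  obtain ⟨g0, g1⟩ := hγ
  have hP : HasSum (fun n => ∑ z, π z n) 1 := h1 ▸ aux_hasSum π hs
  have hl : 0 < lam * (1 - γ) := mul_pos hlam (by linarith)
  have lower : ∀ n : ℕ, κ / lam * ∑ z, π z n ≤ ∑ z, ((n + 1 : ℕ) : ℝ) * π z (n + 1) := by
    intro n
    rw [div_mul_eq_mul_div, div_le_iff₀ hlam, ← aux_flow μ lam γ κ ξ π hb n, Finset.sum_mul]
    refine Finset.sum_le_sum fun z _ => ?_
    have hx := (hξ z (n + 1)).1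
    have : 0 ≤ lam * ((n : ℝ) + 1) * π z (n + 1) * (γ * ξ z (n + 1)) := by
      have := h0 z (n + 1)
      positivity
    push_cast
    linarith
  have upper : ∀ n : ℕ, ∑ z, ((n + 1 : ℕ) : ℝ) * π z (n + 1) ≤
      κ / (lam * (1 - γ)) * ∑ z, π z n := by
    intro n
    rw [div_mul_eq_mul_div, le_div_iff₀ hl, ← aux_flow μ lam γ κ ξ π hb n, Finset.sum_mul]
    refine Finset.sum_le_sum fun z _ => ?_
    have hx := (hξ z (n + 1)).2
    have : 0 ≤ lam * ((n : ℝ) + 1) * π z (n + 1) * (γ * (1 - ξ z (n + 1))) := by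
      have := h0 z (n + 1)
      have : 0 ≤ 1 - ξ z (n + 1) := by linarith
      positivity
    push_cast
    linarith
  have hS : Summable (fun n : ℕ => ∑ z, ((n + 1 : ℕ) : ℝ) * π z (n + 1)) :=
    Summable.of_nonneg_of_le
      (fun n => Finset.sum_nonneg fun z _ => mul_nonneg (Nat.cast_nonneg _) (h0 _ _)) upper
      (hP.summable.mul_left _)
  have hS' : Summable (fun n : ℕ => ∑ z, (n : ℝ) * π z n) :=
    (summable_nat_add_iff (f := fun n : ℕ => ∑ z, (n : ℝ) * π z n) 1).1 hS
  have hsum : Summable (fun p : Z × ℕ => (p.2 : ℝ) * π p.1 p.2) :=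
    aux_summable (fun z n => (n : ℝ) * π z n)
      (fun z n => mul_nonneg (Nat.cast_nonneg _) (h0 _ _)) hS'
  have hH := aux_hasSum (fun z n => (n : ℝ) * π z n) hsum
  have hH' : HasSum (fun n : ℕ => ∑ z, ((n + 1 : ℕ) : ℝ) * π z (n + 1))
      (∑' p : Z × ℕ, (p.2 : ℝ) * π p.1 p.2) := by
    refine (hasSum_nat_add_iff (f := fun n : ℕ => ∑ z, (n : ℝ) * π z n) 1).2 ?_
    simpa using hH
  refine ⟨hsum, ?_, ?_⟩
  · simpa using hasSum_le lower (hP.mul_left _) hH'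
  · simpa using hasSum_le upper hH' (hP.mul_left _)
end

section
/- Fix a Markovian strategy ξ. If κ₁ and κ₂ are arrival rates with β·λ·(1−γ) ≤ κ₁ < κ₂ ≤ β·λ, and π₁, π₂ are probability solutions of the balance equations for (ξ,κ₁) and (ξ,κ₂) respectively, then ∑_{(z,n)∈S} n·π₁(z,n) < ∑_{(z,n)∈S} n·π₂(z,n); that is, for fixed ξ the equilibrium mean number of agents is a strictly increasing function of the arrival rate κ on [β·λ·(1−γ), β·λ]. -/
open scoped BigOperators

variable {Z : Type}

open Filter Topology

section Helpers

variable [Fintype Z] [DecidableEq Z]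

lemma swap_flow (μ : Z → Z → ℝ) (f : Z → ℝ) :
    ∑ x, f x * (∑ y ∈ Finset.univ.filter (fun y => y ≠ x), μ x y)
      = ∑ x, ∑ z ∈ Finset.univ.filter (fun z => z ≠ x), f z * μ z x := by
  simp only [Finset.sum_filter, Finset.mul_sum]
  rw [Finset.sum_comm]
  refine Finset.sum_congr rfl fun x _ => Finset.sum_congr rfl fun y _ => ?_
  by_cases h : x = y
  · subst h; simp
  · have h' : ¬ y = x := fun e => h e.symm
    simp [h, h']

/-- The cumulated balance equation. -/
lemma head_eq {μ : Z → Z → ℝ} {lam γ κ : ℝ} {ξ π : Z → ℕ → ℝ}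
    (hB : Balance μ lam γ κ ξ π) (x : Z) (m : ℕ) :
    (∑ k ∈ Finset.range (m + 1), π x k) * (∑ y ∈ Finset.univ.filter (fun y => y ≠ x), μ x y)
        + κ * π x m
      = (∑ z ∈ Finset.univ.filter (fun z => z ≠ x),
          (∑ k ∈ Finset.range (m + 1), π z k) * μ z x)
        + lam * (m + 1) * (1 - γ * ξ x (m + 1)) * π x (m + 1) := by
  induction m with
  | zero =>
    have h := hB x 0
    simp at h ⊢
    linarith
  | succ m ih =>
    have h := hB x (m + 1)
    simp only [Finset.sum_range_succ _ (m + 1), add_mul, Finset.sum_add_distrib]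
    simp at h
    push_cast at h ⊢
    linarith

/-- Level crossing. -/
lemma level_eq {μ : Z → Z → ℝ} {lam γ κ : ℝ} {ξ π : Z → ℕ → ℝ}
    (hB : Balance μ lam γ κ ξ π) (m : ℕ) :
    κ * ∑ x, π x m = ∑ x, lam * (m + 1) * (1 - γ * ξ x (m + 1)) * π x (m + 1) := by
  have h : ∑ x, _ = ∑ x, _ := Finset.sum_congr rfl fun x (_ : x ∈ Finset.univ) => head_eq hB x m
  rw [Finset.sum_add_distrib, Finset.sum_add_distrib,
    swap_flow μ (fun x => ∑ k ∈ Finset.range (m + 1), π x k)] at h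
  rw [Finset.mul_sum]
  linarith

lemma rate_lower {lam γ : ℝ} (hlam : 0 < lam) (hγ : γ ∈ Set.Ioo (0 : ℝ) 1) {ξ : Z → ℕ → ℝ}
    (hξ : IsStrategy ξ) (x : Z) (m : ℕ) :
    lam * (m + 1) * (1 - γ) ≤ lam * (m + 1) * (1 - γ * ξ x (m + 1)) := by
  have := hξ x (m + 1)
  have h1 := hγ.1
  gcongr
  nlinarith

/-- Everything we need about a probability solution. -/
lemma sol_facts [Nonempty Z] {μ : Z → Z → ℝ} (hμ : ∀ z y : Z, z ≠ y → 0 < μ z y)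
    {lam γ κ : ℝ} (hlam : 0 < lam) (hγ : γ ∈ Set.Ioo (0 : ℝ) 1) {ξ π : Z → ℕ → ℝ}
    (hξ : IsStrategy ξ) (hκ : 0 < κ) (hπ : IsProbSolution μ lam γ κ ξ π) :
    HasSum (fun m => ∑ x, π x m) 1 ∧
    HasSum (fun m : ℕ => (m : ℝ) * ∑ x, π x m) (∑' p : Z × ℕ, (p.2 : ℝ) * π p.1 p.2) ∧
    ∃ p : Z → ℝ, (∀ x, 0 < p x) ∧ ∑ x, p x = 1 ∧
      (∀ x, Tendsto (fun m => ∑ k ∈ Finset.range m, π x k) atTop (𝓝 (p x))) ∧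
      (∀ x, p x * (∑ y ∈ Finset.univ.filter (fun y => y ≠ x), μ x y)
        = ∑ z ∈ Finset.univ.filter (fun z => z ≠ x), p z * μ z x) := by
  obtain ⟨h0, hs, h1, hB⟩ := hπ
  have hx : ∀ x, Summable (π x) := fun x => hs.prod_factor x
  have hq : Summable (fun m => ∑ x, π x m) := summable_sum fun x _ => hx x
  have htot : ∑ x, ∑' m, π x m = 1 := by
    rw [← h1, hs.tsum_prod, tsum_fintype]
  have hq1 : HasSum (fun m => ∑ x, π x m) 1 := by
    rw [← htot]; exact hasSum_sum fun x _ => (hx x).hasSum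
  have hg1 : 0 < 1 - γ := by linarith [hγ.2]
  have hle : ∀ m : ℕ, ((m : ℝ) + 1) * ∑ x, π x (m + 1) ≤ κ / (lam * (1 - γ)) * ∑ x, π x m := by
    intro m
    have h : lam * (m + 1) * (1 - γ) * ∑ x, π x (m + 1) ≤ κ * ∑ x, π x m := by
      rw [level_eq hB m, Finset.mul_sum]
      exact Finset.sum_le_sum fun x _ =>
        mul_le_mul_of_nonneg_right (rate_lower hlam hγ hξ x m) (h0 _ _)
    rw [div_mul_eq_mul_div, le_div_iff₀ (by positivity)]
    linarith
  have hmq : Summable (fun m : ℕ => (m : ℝ) * ∑ x, π x m) := by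
    rw [← summable_nat_add_iff 1]
    refine Summable.of_nonneg_of_le (fun m => ?_) (fun m => ?_) (hq.mul_left (κ / (lam * (1 - γ))))
    · exact mul_nonneg (by positivity) (Finset.sum_nonneg fun x _ => h0 _ _)
    · push_cast; exact hle m
  have hmx : ∀ x, Summable (fun m : ℕ => (m : ℝ) * π x m) := by
    intro x
    refine Summable.of_nonneg_of_le (fun m => ?_) (fun m => ?_) hmq
    · exact mul_nonneg (by positivity) (h0 _ _)
    · exact mul_le_mul_of_nonneg_left
        (Finset.single_le_sum (fun y _ => h0 y m) (Finset.mem_univ x)) (by positivity)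
  have hprod : Summable (fun p : Z × ℕ => (p.2 : ℝ) * π p.1 p.2) := by
    rw [summable_prod_of_nonneg (fun p => mul_nonneg (by positivity) (h0 _ _))]
    exact ⟨hmx, (hasSum_fintype _).summable⟩
  have hmean : HasSum (fun m : ℕ => (m : ℝ) * ∑ x, π x m)
      (∑' p : Z × ℕ, (p.2 : ℝ) * π p.1 p.2) := by
    rw [hprod.tsum_prod, tsum_fintype]
    simp only [Finset.mul_sum]
    exact hasSum_sum fun x _ => (hmx x).hasSum
  refine ⟨hq1, hmean, fun x => ∑' m, π x m, ?_⟩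
  have ht : ∀ x, Tendsto (fun m => ∑ k ∈ Finset.range m, π x k) atTop (𝓝 (∑' m, π x m)) :=
    fun x => (hx x).hasSum.tendsto_sum_nat
  have hst : ∀ x, (∑' m, π x m) * (∑ y ∈ Finset.univ.filter (fun y => y ≠ x), μ x y)
        = ∑ z ∈ Finset.univ.filter (fun z => z ≠ x), (∑' m, π z m) * μ z x := by
    intro x
    have hd : Tendsto (fun m : ℕ => lam * (m + 1) * (1 - γ * ξ x (m + 1)) * π x (m + 1))
        atTop (𝓝 0) := by
      have hz : Tendsto (fun m : ℕ => κ * ∑ x, π x m) atTop (𝓝 0) := by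
        simpa using hq.tendsto_atTop_zero.const_mul κ
      have hnn : ∀ (m : ℕ) (y : Z), 0 ≤ lam * (m + 1) * (1 - γ * ξ y (m + 1)) * π y (m + 1) :=
        fun m y => mul_nonneg ((by positivity : (0:ℝ) ≤ lam * (m + 1) * (1 - γ)).trans
          (rate_lower hlam hγ hξ y m)) (h0 _ _)
      refine squeeze_zero (fun m => hnn m x) (fun m => ?_) hz
      rw [level_eq hB m]
      exact Finset.single_le_sum
        (f := fun y => lam * (m + 1) * (1 - γ * ξ y (m + 1)) * π y (m + 1))
        (fun y _ => hnn m y) (Finset.mem_univ x)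
    have hL := (((tendsto_add_atTop_iff_nat 1).2 (ht x)).mul_const
      (∑ y ∈ Finset.univ.filter (fun y => y ≠ x), μ x y)).add
      ((hx x).tendsto_atTop_zero.const_mul κ)
    have hR := (tendsto_finsetSum (Finset.univ.filter (fun z => z ≠ x)) fun z _ =>
      ((tendsto_add_atTop_iff_nat 1).2 (ht z)).mul_const (μ z x)).add hd
    have := tendsto_nhds_unique (hL.congr fun m => head_eq hB x m) hR
    simpa using this
  refine ⟨fun x => ?_, htot, ht, hst⟩
  have hp0 : ∀ x, 0 ≤ ∑' m, π x m := fun x => tsum_nonneg (h0 x)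
  refine lt_of_le_of_ne (hp0 x) fun hz => ?_
  have hz : 0 = ∑' m, π x m := hz
  have h := hst x
  rw [← hz, zero_mul] at h
  have h' := (Finset.sum_eq_zero_iff_of_nonneg (fun z hz => mul_nonneg (hp0 z)
    (hμ z x (Finset.mem_filter.1 hz).2).le)).1 h.symm
  have : ∑ y, ∑' m, π y m = 0 := by
    refine Finset.sum_eq_zero fun y _ => ?_
    by_cases hy : y = x
    · rw [hy, ← hz]
    · have := h' y (by simp [hy])
      exact (mul_eq_zero.1 this).resolve_right (hμ y x hy).ne'
  linarith

lemma stat_unique [Nonempty Z] {μ : Z → Z → ℝ} (hμ : ∀ z y : Z, z ≠ y → 0 < μ z y)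
    {p q : Z → ℝ} (hp : ∀ x, 0 < p x) (hp1 : ∑ x, p x = 1) (hq1 : ∑ x, q x = 1)
    (hps : ∀ x, p x * (∑ y ∈ Finset.univ.filter (fun y => y ≠ x), μ x y)
        = ∑ z ∈ Finset.univ.filter (fun z => z ≠ x), p z * μ z x)
    (hqs : ∀ x, q x * (∑ y ∈ Finset.univ.filter (fun y => y ≠ x), μ x y)
        = ∑ z ∈ Finset.univ.filter (fun z => z ≠ x), q z * μ z x) : p = q := by
  obtain ⟨x, -, hx⟩ := Finset.exists_min_image Finset.univ (fun x => q x / p x)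
    Finset.univ_nonempty
  set c := q x / p x with hc
  have hqx : q x = c * p x := by rw [hc, div_mul_cancel₀ _ (hp x).ne']
  have hge : ∀ z, 0 ≤ q z - c * p z := by
    intro z
    have := (le_div_iff₀ (hp z)).1 (hx z (Finset.mem_univ z))
    linarith
  have hsum : ∑ z ∈ Finset.univ.filter (fun z => z ≠ x), (q z - c * p z) * μ z x = 0 := by
    have h1 := hqs x
    rw [hqx, mul_assoc, hps x, Finset.mul_sum] at h1
    simp only [sub_mul, Finset.sum_sub_distrib, mul_assoc]
    linarith
  have h' := (Finset.sum_eq_zero_iff_of_nonneg (fun z hz => mul_nonneg (hge z)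
    (hμ z x (Finset.mem_filter.1 hz).2).le)).1 hsum
  have hall : ∀ z, q z = c * p z := by
    intro z
    by_cases hz : z = x
    · rw [hz, hqx]
    · have := (mul_eq_zero.1 (h' z (by simp [hz]))).resolve_right (hμ z x hz).ne'
      linarith
  have hc1 : c = 1 := by
    have : ∑ z, q z = c * ∑ z, p z := by
      rw [Finset.mul_sum]; exact Finset.sum_congr rfl fun z _ => hall z
    rw [hp1, hq1] at this; linarith
  funext z
  rw [hall z, hc1, one_mul]

/-- Minimum principle. -/
lemma min_principle {μ : Z → Z → ℝ} (hμ : ∀ z y : Z, z ≠ y → 0 < μ z y)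
    {p : Z → ℝ} (hp : ∀ x, 0 < p x)
    (hps : ∀ x, p x * (∑ y ∈ Finset.univ.filter (fun y => y ≠ x), μ x y)
        = ∑ z ∈ Finset.univ.filter (fun z => z ≠ x), p z * μ z x)
    {κ : ℝ} (hκ : 0 < κ) {d : Z → ℕ → ℝ} (hd : ∀ x m, 0 ≤ d x m)
    {D : Z → ℕ → ℝ} (hD0 : ∀ x, D x 0 = 0) (hDt : ∀ x, Tendsto (D x) atTop (𝓝 0))
    (hsup : ∀ x m, (∑ z ∈ Finset.univ.filter (fun z => z ≠ x), D z (m + 1) * μ z x)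
        + κ * (D x m - D x (m + 1)) + d x m * (D x (m + 2) - D x (m + 1))
        ≤ D x (m + 1) * (∑ y ∈ Finset.univ.filter (fun y => y ≠ x), μ x y)) :
    ∀ x m, 0 ≤ D x m := by
  by_contra! hneg
  obtain ⟨x0, m0, hneg⟩ := hneg
  have hEt : ∀ x, Tendsto (fun m => D x m / p x) atTop (𝓝 0) := fun x => by
    simpa using (hDt x).div_const (p x)
  have hE0 : D x0 m0 / p x0 < 0 := div_neg_of_neg_of_pos hneg (hp x0)
  have hev : ∀ᶠ m in atTop, ∀ x, D x0 m0 / p x0 < D x m / p x :=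
    eventually_all.2 fun x => (hEt x).eventually (lt_mem_nhds hE0)
  obtain ⟨N, hN⟩ := eventually_atTop.1 hev
  obtain ⟨⟨x1, m1⟩, hm, hmin⟩ := Finset.exists_min_image
    ((Finset.univ : Finset Z) ×ˢ Finset.range (N + m0 + 1)) (fun a => D a.1 a.2 / p a.1)
    ⟨(x0, m0), by simp⟩
  simp only at hmin
  set c := D x1 m1 / p x1 with hc
  have hc0 : c ≤ D x0 m0 / p x0 := hmin (x0, m0) (by simp)
  have hcneg : c < 0 := hc0.trans_lt hE0
  have hglob : ∀ x m, c * p x ≤ D x m := by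
    intro x m
    rw [← le_div_iff₀ (hp x)]
    by_cases h : m < N + m0 + 1
    · exact hmin (x, m) (by simp; omega)
    · exact hc0.trans (hN m (by omega) x).le
  have hno : ∀ m x, D x m ≠ c * p x := by
    intro m
    induction m with
    | zero => intro x h; rw [hD0] at h; nlinarith [hp x]
    | succ m ih =>
      intro x h
      have h1 := hsup x m
      rw [h, mul_assoc, hps x, Finset.mul_sum] at h1
      have h2 : ∑ z ∈ Finset.univ.filter (fun z => z ≠ x), c * (p z * μ z x)
          ≤ ∑ z ∈ Finset.univ.filter (fun z => z ≠ x), D z (m + 1) * μ z x := by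
        refine Finset.sum_le_sum fun z hz => ?_
        rw [← mul_assoc]
        exact mul_le_mul_of_nonneg_right (hglob z _) (hμ z x (Finset.mem_filter.1 hz).2).le
      have h3 : 0 ≤ d x m * (D x (m + 2) - c * p x) :=
        mul_nonneg (hd x m) (by linarith [hglob x (m + 2)])
      have h4 : 0 < κ * (D x m - c * p x) :=
        mul_pos hκ (sub_pos.2 (lt_of_le_of_ne (hglob x m) (ih x).symm))
      linarith
  exact hno m1 x1 (by rw [hc, div_mul_cancel₀ _ (hp x1).ne'])

end Helpers

/-- Comparison of means from comparison of the cumulated distribution functions. -/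
lemma mean_compare {q₁ q₂ : ℕ → ℝ} {M₁ M₂ : ℝ} (hq1 : ∀ m, 0 ≤ q₁ m) (hq2 : ∀ m, 0 ≤ q₂ m)
    (h1 : HasSum q₁ 1) (h2 : HasSum q₂ 1)
    (hM1 : HasSum (fun m : ℕ => (m : ℝ) * q₁ m) M₁)
    (hM2 : HasSum (fun m : ℕ => (m : ℝ) * q₂ m) M₂)
    {D : ℕ → ℝ}
    (hD : ∀ m, D m = ∑ k ∈ Finset.range m, q₁ k - ∑ k ∈ Finset.range m, q₂ k)
    (hD0 : ∀ m, 0 ≤ D m) (m0 : ℕ) (hpos : 0 < D (m0 + 1)) : M₁ < M₂ := by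
  have habel : ∀ N : ℕ, ∑ m ∈ Finset.range N, (m : ℝ) * q₂ m - ∑ m ∈ Finset.range N, (m : ℝ) * q₁ m
      = ∑ m ∈ Finset.range N, D (m + 1) - N * D N := by
    intro N
    induction N with
    | zero => simp
    | succ N ih =>
      rw [Finset.sum_range_succ, Finset.sum_range_succ, Finset.sum_range_succ]
      have : D (N + 1) = D N + q₁ N - q₂ N := by
        rw [hD, hD, Finset.sum_range_succ, Finset.sum_range_succ]; ring
      push_cast
      rw [this]
      linarith
  have htail : ∀ N : ℕ, N * D N ≤ ∑' k, ((k + N : ℕ) : ℝ) * q₂ (k + N) := by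
    intro N
    have e1 : ∑ k ∈ Finset.range N, q₁ k ≤ 1 := sum_le_hasSum _ (fun k _ => hq1 k) h1
    have e2 : ∑ k ∈ Finset.range N, q₂ k + ∑' k, q₂ (k + N) = 1 := by
      rw [h2.summable.sum_add_tsum_nat_add, h2.tsum_eq]
    have e3 : D N ≤ ∑' k, q₂ (k + N) := by rw [hD]; linarith
    calc (N : ℝ) * D N ≤ N * ∑' k, q₂ (k + N) := by gcongr
      _ = ∑' k, N * q₂ (k + N) := by rw [tsum_mul_left]
      _ ≤ _ := by
        refine Summable.tsum_le_tsum (fun k => ?_)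
          (((summable_nat_add_iff N).2 h2.summable).mul_left _)
          ((summable_nat_add_iff (f := fun m : ℕ => (m : ℝ) * q₂ m) N).2 hM2.summable)
        have := hq2 (k + N)
        gcongr
        omega
  have hlim : Tendsto (fun N : ℕ => D (m0 + 1) - ∑' k, ((k + N : ℕ) : ℝ) * q₂ (k + N)) atTop
      (𝓝 (D (m0 + 1) - 0)) :=
    tendsto_const_nhds.sub (tendsto_sum_nat_add (fun m : ℕ => (m : ℝ) * q₂ m))
  have hle := le_of_tendsto_of_tendsto hlim
    (hM2.tendsto_sum_nat.sub hM1.tendsto_sum_nat) (by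
      filter_upwards [eventually_ge_atTop (m0 + 1)] with N hN
      rw [habel N]
      have := Finset.single_le_sum (f := fun m => D (m + 1)) (s := Finset.range N)
        (fun m _ => hD0 (m + 1)) (Finset.mem_range.2 (show m0 < N by omega))
      have := htail N
      linarith)
  linarith

/-- **Strict monotonicity of the mean number of agents in the arrival rate**
(Lemma 5 of the paper): for a fixed strategy `ξ`, if
`βλ(1-γ) ≤ κ₁ < κ₂ ≤ βλ`, the stationary mean number of agents for `κ₁` is
strictly smaller than that for `κ₂`. -/
theorem mean_agents_strict_mono (Z : Type) [Fintype Z] [DecidableEq Z] [Nonempty Z]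
    (μ : Z → Z → ℝ) (hμ : ∀ z y : Z, z ≠ y → 0 < μ z y)
    (lam γ β : ℝ) (hlam : 0 < lam) (hγ : γ ∈ Set.Ioo (0 : ℝ) 1) (hβ : 0 < β)
    (ξ : Z → ℕ → ℝ) (hξ : IsStrategy ξ)
    (κ₁ κ₂ : ℝ) (h₁ : β * lam * (1 - γ) ≤ κ₁) (h₁₂ : κ₁ < κ₂) (h₂ : κ₂ ≤ β * lam)
    (π₁ π₂ : Z → ℕ → ℝ)
    (hπ₁ : IsProbSolution μ lam γ κ₁ ξ π₁)
    (hπ₂ : IsProbSolution μ lam γ κ₂ ξ π₂) :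
    (∑' p : Z × ℕ, (p.2 : ℝ) * π₁ p.1 p.2) < ∑' p : Z × ℕ, (p.2 : ℝ) * π₂ p.1 p.2 := by
  have hg1 : 0 < 1 - γ := by linarith [hγ.2]
  have hκ₁ : 0 < κ₁ := lt_of_lt_of_le (by positivity) h₁
  obtain ⟨hs1, hm1, p, hp, hp1, hpt, hps⟩ := sol_facts hμ hlam hγ hξ hκ₁ hπ₁
  obtain ⟨hs2, hm2, q, hq, hq1, hqt, hqs⟩ := sol_facts hμ hlam hγ hξ (hκ₁.trans h₁₂) hπ₂
  obtain rfl : p = q := stat_unique hμ hp hp1 hq1 hps hqs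
  set D : Z → ℕ → ℝ := fun x m =>
    ∑ k ∈ Finset.range m, π₁ x k - ∑ k ∈ Finset.range m, π₂ x k with hD
  have hDsucc : ∀ x m, D x (m + 1) = D x m + π₁ x m - π₂ x m := by
    intro x m
    simp only [hD, Finset.sum_range_succ]; ring
  have hkey : ∀ x m, (∑ z ∈ Finset.univ.filter (fun z => z ≠ x), D z (m + 1) * μ z x)
        + κ₁ * (D x m - D x (m + 1))
        + lam * (m + 1) * (1 - γ * ξ x (m + 1)) * (D x (m + 2) - D x (m + 1))
        + (κ₂ - κ₁) * π₂ x m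
        = D x (m + 1) * (∑ y ∈ Finset.univ.filter (fun y => y ≠ x), μ x y) := by
    intro x m
    have e1 := head_eq hπ₁.2.2.2 x m
    have e2 := head_eq hπ₂.2.2.2 x m
    have e3 : D x m - D x (m + 1) = π₂ x m - π₁ x m := by rw [hDsucc]; ring
    have e4 : D x (m + 2) - D x (m + 1) = π₁ x (m + 1) - π₂ x (m + 1) := by
      rw [hDsucc x (m + 1)]; ring
    rw [e3, e4]
    simp only [hD, sub_mul, Finset.sum_sub_distrib]
    linarith
  have hnn : ∀ x m, 0 ≤ D x m := by
    refine min_principle hμ hp hps hκ₁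
      (d := fun x m => lam * (m + 1) * (1 - γ * ξ x (m + 1))) (fun x m => ?_) (fun x => ?_)
      (fun x => ?_) (fun x m => ?_)
    · exact (by positivity : (0:ℝ) ≤ lam * (m + 1) * (1 - γ)).trans (rate_lower hlam hγ hξ x m)
    · simp [hD]
    · simpa using (hpt x).sub (hqt x)
    · have := hkey x m
      have := mul_nonneg (sub_pos.2 h₁₂).le (hπ₂.1 x m)
      linarith
  have hex : ∃ m, 0 < ∑ x, D x (m + 1) := by
    by_contra! hno
    have hz : ∀ x m, D x m = 0 := by
      intro x m
      cases m with
      | zero => simp [hD]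
      | succ m =>
        have := Finset.single_le_sum (f := fun y => D y (m + 1)) (fun y _ => hnn y (m + 1))
          (Finset.mem_univ x)
        exact le_antisymm (this.trans (hno m)) (hnn x _)
    have hz2 : ∀ x m, π₂ x m = 0 := by
      intro x m
      have := hkey x m
      simp only [hz] at this
      simp at this
      exact this.resolve_left (sub_pos.2 h₁₂).ne'
    have := hπ₂.2.2.1
    simp [hz2] at this
  obtain ⟨m0, hm0⟩ := hex
  refine mean_compare (D := fun m => ∑ x, D x m)
    (fun m => Finset.sum_nonneg fun x _ => hπ₁.1 x m)
    (fun m => Finset.sum_nonneg fun x _ => hπ₂.1 x m) hs1 hs2 hm1 hm2 (fun m => ?_)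
    (fun m => Finset.sum_nonneg fun x _ => hnn x m) m0 hm0
  simp only [hD, Finset.sum_sub_distrib]
  rw [Finset.sum_comm, Finset.sum_comm (s := Finset.univ)]
end

section
/- Fix a Markovian strategy ξ and let κ₁, κ₂ be arrival rates with 0 < κ₁ < κ₂. If a single summable nonnegative function π : S → [0,∞) satisfies the balance equations simultaneously for (ξ,κ₁) and for (ξ,κ₂), then π(z,n) = π(z,n−1) for all z ∈ Z and all n ≥ 1, and consequently π = 0; in particular, no probability distribution on S can satisfy the balance equations for two distinct positive arrival rates under the same strategy. -/
open scoped BigOperators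

variable {Z : Type}

/-- **No distribution is stationary for two distinct arrival rates** (from the proof
of Lemma 5 of the paper): if a summable nonnegative `π` satisfies the balance
equations for both `(ξ, κ₁)` and `(ξ, κ₂)` with `0 < κ₁ < κ₂`, then
`π(z,n) = π(z,n-1)` for all `n ≥ 1`, hence `π = 0`; in particular no probability
distribution satisfies the balance equations for two distinct positive arrival
rates under the same strategy. -/
theorem no_common_stationary (Z : Type) [Fintype Z] [DecidableEq Z] [Nonempty Z]
    (μ : Z → Z → ℝ) (hμ : ∀ z y : Z, z ≠ y → 0 < μ z y)
    (lam γ : ℝ) (hlam : 0 < lam) (hγ : γ ∈ Set.Ioo (0 : ℝ) 1)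
    (ξ : Z → ℕ → ℝ) (hξ : IsStrategy ξ)
    (κ₁ κ₂ : ℝ) (h₀ : 0 < κ₁) (h₁₂ : κ₁ < κ₂)
    (π : Z → ℕ → ℝ) (hπ0 : ∀ z n, 0 ≤ π z n)
    (hsum : Summable (fun p : Z × ℕ => π p.1 p.2))
    (hb₁ : Balance μ lam γ κ₁ ξ π) (hb₂ : Balance μ lam γ κ₂ ξ π) :
    (∀ z : Z, ∀ n : ℕ, 1 ≤ n → π z n = π z (n - 1)) ∧
    (∀ z : Z, ∀ n : ℕ, π z n = 0) := by
  have key : ∀ x m, π x m = if 1 ≤ m then π x (m - 1) else 0 := by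
    intro x m
    have e₁ := hb₁ x m
    have e₂ := hb₂ x m
    have h : (κ₂ - κ₁) * (π x m - if 1 ≤ m then π x (m - 1) else 0) = 0 := by
      linear_combination e₂ - e₁
    rcases mul_eq_zero.mp h with h | h
    · linarith
    · linarith
  refine ⟨fun z n hn => ?_, fun z n => ?_⟩
  · have h := key z n
    rwa [if_pos hn] at h
  · induction n with
    | zero => simpa using key z 0
    | succ k ih =>
      have h := key z (k + 1)
      rw [if_pos (by omega), Nat.add_sub_cancel] at h
      rw [h, ih]
end

section
/- For every Markovian strategy ξ and every arrival rate κ ≥ 0, there exists a unique probability solution of the balance equations for (ξ,κ); that is, there is exactly one summable π : S → [0,∞) with ∑_{(z,n)∈S} π(z,n) = 1 satisfying the balance equations for (ξ,κ). -/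
open scoped BigOperators

variable {Z : Type}

theorem aux_finite_stationary {S : Type} [Fintype S] [DecidableEq S] [Nonempty S]
    (q : S → S → ℝ) (hq : ∀ x y, 0 ≤ q x y) :
    ∃ v : S → ℝ, (∀ x, 0 ≤ v x) ∧ ∑ x, v x = 1 ∧
      ∀ x, v x * ∑ y, q x y = ∑ y, v y * q y x := by
  classical
  let M : Matrix S S ℝ := fun x y => q x y - if x = y then ∑ z, q x z else 0
  have hdet : M.det = 0 := by
    apply Matrix.exists_mulVec_eq_zero_iff.mp
    refine ⟨fun _ => 1, ?_, ?_⟩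
    · intro h
      have := congrFun h (Classical.arbitrary S)
      simp at this
    · funext x
      simp [Matrix.mulVec, dotProduct, M, Finset.sum_sub_distrib]
  obtain ⟨v, hv0, hv⟩ := Matrix.exists_vecMul_eq_zero_iff.mpr hdet
  have hbal : ∀ x, v x * ∑ y, q x y = ∑ y, v y * q y x := by
    intro x
    have := congrFun hv x
    simp only [Matrix.vecMul, dotProduct, M, mul_sub, Finset.sum_sub_distrib, mul_ite, mul_zero,
      Finset.sum_ite_eq', Finset.mem_univ, if_true, Pi.zero_apply] at this
    linarith
  have hle : ∀ x ∈ Finset.univ, |v x| * ∑ y, q x y ≤ ∑ y, |v y| * q y x := by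
    intro x _
    have h0 : 0 ≤ ∑ y, q x y := Finset.sum_nonneg fun y _ => hq x y
    calc |v x| * ∑ y, q x y = |v x * ∑ y, q x y| := by rw [abs_mul, abs_of_nonneg h0]
      _ = |∑ y, v y * q y x| := by rw [hbal x]
      _ ≤ ∑ y, |v y * q y x| := Finset.abs_sum_le_sum_abs _ _
      _ = ∑ y, |v y| * q y x := by
        refine Finset.sum_congr rfl fun y _ => ?_
        rw [abs_mul, abs_of_nonneg (hq y x)]
  have hsum : ∑ x, |v x| * ∑ y, q x y = ∑ x, ∑ y, |v y| * q y x := by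
    rw [Finset.sum_comm]
    simp only [Finset.mul_sum]
  have heq := (Finset.sum_eq_sum_iff_of_le hle).mp hsum
  have hpos : 0 < ∑ x, |v x| := by
    obtain ⟨x, hx⟩ := Function.ne_iff.mp hv0
    exact Finset.sum_pos' (fun _ _ => abs_nonneg _) ⟨x, Finset.mem_univ _, abs_pos.mpr hx⟩
  refine ⟨fun x => |v x| / ∑ x, |v x|, fun x => by positivity, ?_, ?_⟩
  · rw [← Finset.sum_div, div_self hpos.ne']
  · intro x
    have := heq x (Finset.mem_univ x)
    rw [div_mul_eq_mul_div, this, Finset.sum_div]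
    refine Finset.sum_congr rfl fun y _ => ?_
    ring

/-- Inflow minus outflow at a state. -/
noncomputable def auxDef [Fintype Z] [DecidableEq Z] (μ : Z → Z → ℝ) (κ : ℝ) (d π : Z → ℕ → ℝ)
    (x : Z) (m : ℕ) : ℝ :=
  (∑ z ∈ Finset.univ.filter (fun z => z ≠ x), π z m * μ z x)
        + κ * (if 1 ≤ m then π x (m - 1) else 0)
        + d x (m + 1) * π x (m + 1)
   - π x m * ((∑ y ∈ Finset.univ.filter (fun y => y ≠ x), μ x y) + κ + d x m)

/-- Net flow across a cut. -/
noncomputable def auxCut [Fintype Z] (κ : ℝ) (d π : Z → ℕ → ℝ) (m : ℕ) : ℝ :=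
  ∑ x, d x (m + 1) * π x (m + 1) - κ * ∑ x, π x m

theorem aux_swap_s12 [Fintype Z] [DecidableEq Z] (μ : Z → Z → ℝ) (f : Z → ℝ) :
    ∑ x, ∑ z ∈ Finset.univ.filter (fun z => z ≠ x), f z * μ z x
      = ∑ x, f x * ∑ y ∈ Finset.univ.filter (fun y => y ≠ x), μ x y := by
  simp only [Finset.sum_filter, Finset.mul_sum]
  rw [Finset.sum_comm]
  refine Finset.sum_congr rfl fun x _ => Finset.sum_congr rfl fun y _ => ?_
  by_cases h : x = y
  · simp [h]
  · have h' : y ≠ x := fun e => h e.symm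
    simp [h, h']

theorem aux_cut_zero [Fintype Z] [DecidableEq Z] (μ : Z → Z → ℝ) (κ : ℝ) (d π : Z → ℕ → ℝ)
    (hd0 : ∀ x, d x 0 = 0) : ∑ x, auxDef μ κ d π x 0 = auxCut κ d π 0 := by
  simp only [auxDef, auxCut, Finset.sum_sub_distrib, Finset.sum_add_distrib, mul_add, aux_swap_s12]
  simp [hd0, Finset.mul_sum, mul_comm]

theorem aux_cut_succ [Fintype Z] [DecidableEq Z] (μ : Z → Z → ℝ) (κ : ℝ) (d π : Z → ℕ → ℝ)
    (m : ℕ) : ∑ x, auxDef μ κ d π x (m + 1) = auxCut κ d π (m + 1) - auxCut κ d π m := by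
  simp only [auxDef, auxCut, Finset.sum_sub_distrib, Finset.sum_add_distrib, mul_add, aux_swap_s12]
  simp only [← Finset.sum_mul, ← Finset.mul_sum, Nat.add_sub_cancel, Nat.le_add_left, if_true]
  have : ∑ x, π x (m + 1) * d x (m + 1) = ∑ x, d x (m + 1) * π x (m + 1) :=
    Finset.sum_congr rfl fun x _ => mul_comm _ _
  rw [this]
  ring

theorem aux_cut_eq [Fintype Z] [DecidableEq Z] (μ : Z → Z → ℝ) (κ : ℝ) (d π : Z → ℕ → ℝ)
    (hd0 : ∀ x, d x 0 = 0) (m : ℕ) (h : ∀ k ≤ m, ∀ x, auxDef μ κ d π x k = 0) :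
    auxCut κ d π m = 0 := by
  induction m with
  | zero => rw [← aux_cut_zero μ κ d π hd0]; exact Finset.sum_eq_zero fun x _ => h 0 le_rfl x
  | succ m ih =>
    have h1 := aux_cut_succ μ κ d π m
    rw [ih fun k hk => h k (by omega), Finset.sum_eq_zero fun x _ => h (m + 1) le_rfl x] at h1
    linarith

theorem aux_zero [Fintype Z] [DecidableEq Z] (μ : Z → Z → ℝ)
    (hμ : ∀ z y : Z, z ≠ y → 0 < μ z y) (κ : ℝ) (d π : Z → ℕ → ℝ)
    (hd0 : ∀ x, d x 0 = 0) (hdp : ∀ x m, 0 < d x (m + 1))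
    (hπ : ∀ x m, 0 ≤ π x m) (h : ∀ x m, auxDef μ κ d π x m = 0)
    (x0 : Z) (hx0 : π x0 0 = 0) : ∀ m x, π x m = 0 := by
  intro m
  induction m with
  | zero =>
    intro z
    by_cases hz : z = x0
    · rw [hz, hx0]
    have hb := h x0 0
    simp only [auxDef, hx0] at hb
    have h1 : 0 ≤ d x0 (0 + 1) * π x0 (0 + 1) := mul_nonneg (hdp _ _).le (hπ _ _)
    have hnn : ∀ z ∈ Finset.univ.filter (fun z => z ≠ x0), 0 ≤ π z 0 * μ z x0 := by
      intro z hz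
      exact mul_nonneg (hπ _ _) (hμ _ _ (by simpa using hz)).le
    have h2 := Finset.sum_nonneg hnn
    have h3 : ∑ z ∈ Finset.univ.filter (fun z => z ≠ x0), π z 0 * μ z x0 = 0 := by
      simp at hb h1 h2 ⊢
      linarith
    have h4 := (Finset.sum_eq_zero_iff_of_nonneg hnn).mp h3 z (by simpa using hz)
    rcases mul_eq_zero.mp h4 with h5 | h5
    · exact h5
    · exact absurd h5 (hμ _ _ hz).ne'
  | succ m ih =>
    intro z
    have hc := aux_cut_eq μ κ d π hd0 m fun k _ x => h x k
    simp only [auxCut, ih, Finset.sum_const_zero, mul_zero, sub_zero] at hc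
    have h4 := (Finset.sum_eq_zero_iff_of_nonneg fun x _ =>
      mul_nonneg (hdp x m).le (hπ x (m + 1))).mp hc z (Finset.mem_univ z)
    rcases mul_eq_zero.mp h4 with h5 | h5
    · exact absurd h5 (hdp _ _).ne'
    · exact h5

theorem aux_abs [Fintype Z] [DecidableEq Z] (μ : Z → Z → ℝ)
    (hμ : ∀ z y : Z, z ≠ y → 0 < μ z y) (κ : ℝ) (hκ : 0 ≤ κ) (d v g : Z → ℕ → ℝ)
    (hd0 : ∀ x, d x 0 = 0) (hdp : ∀ x m, 0 < d x (m + 1))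
    (h : ∀ x m, auxDef μ κ d v x m = 0)
    (hg : ∀ x m, auxDef μ κ d g x m = 0)
    (hvg : ∀ x m, |v x m| ≤ g x m)
    (hlim : ∀ x, Filter.Tendsto (fun m => g x m) Filter.atTop (nhds 0)) :
    ∀ x m, auxDef μ κ d (fun x m => |v x m|) x m = 0 := by
  have hdn : ∀ x m, 0 ≤ d x m := by
    intro x m
    cases m with
    | zero => rw [hd0]
    | succ m => exact (hdp x m).le
  have hdef : ∀ x m, 0 ≤ auxDef μ κ d (fun x m => |v x m|) x m := by
    intro x m
    have hb := h x m
    simp only [auxDef] at hb ⊢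
    have hO : 0 ≤ (∑ y ∈ Finset.univ.filter (fun y => y ≠ x), μ x y) + κ + d x m := by
      have : 0 ≤ ∑ y ∈ Finset.univ.filter (fun y => y ≠ x), μ x y :=
        Finset.sum_nonneg fun y hy => (hμ _ _ (by simpa [eq_comm] using hy)).le
      have := hdn x m
      linarith
    rw [sub_nonneg, ← abs_of_nonneg hO, ← abs_mul, ← sub_eq_zero.mp hb]
    refine (abs_add_three _ _ _).trans ?_
    gcongr ?_ + ?_ + ?_
    · refine (Finset.abs_sum_le_sum_abs _ _).trans (Finset.sum_le_sum fun z hz => ?_)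
      rw [abs_mul, abs_of_pos (hμ z x (by simpa using hz))]
    · rw [abs_mul, abs_of_nonneg hκ]
      split_ifs <;> simp
    · rw [abs_mul, abs_of_nonneg (hdn _ _)]
  set w : Z → ℕ → ℝ := fun x m => |v x m| with hw
  have hmono : Monotone (auxCut κ d w) := by
    refine monotone_nat_of_le_succ fun m => ?_
    have h1 := aux_cut_succ μ κ d w m
    have h2 := Finset.sum_nonneg fun x (_ : x ∈ Finset.univ) => hdef x (m + 1)
    linarith
  have hub : ∀ m, auxCut κ d w m ≤ κ * ∑ x, g x m := by
    intro m
    have h1 := aux_cut_eq μ κ d g hd0 m fun k _ x => hg x k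
    have h2 : ∑ x, d x (m + 1) * w x (m + 1) ≤ ∑ x, d x (m + 1) * g x (m + 1) :=
      Finset.sum_le_sum fun x _ => mul_le_mul_of_nonneg_left (hvg _ _) (hdn _ _)
    have h3 : 0 ≤ κ * ∑ x, w x m :=
      mul_nonneg hκ (Finset.sum_nonneg fun x _ => abs_nonneg _)
    simp only [auxCut] at h1 ⊢
    linarith
  have hlim' : Filter.Tendsto (fun m => κ * ∑ x, g x m) Filter.atTop (nhds 0) := by
    have := (tendsto_finsetSum Finset.univ fun x _ => hlim x).const_mul κ
    simpa using this
  have hle : ∀ m, auxCut κ d w m ≤ 0 := by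
    intro m
    refine ge_of_tendsto hlim' ?_
    filter_upwards [Filter.eventually_ge_atTop m] with n hn
    exact (hmono hn).trans (hub n)
  have h0 := aux_cut_zero μ κ d w hd0
  have hge : ∀ m, 0 ≤ auxCut κ d w m := by
    intro m
    refine le_trans ?_ (hmono (Nat.zero_le m))
    rw [← h0]
    exact Finset.sum_nonneg fun x _ => hdef x 0
  have hz : ∀ m, auxCut κ d w m = 0 := fun m => le_antisymm (hle m) (hge m)
  intro x m
  have hs : ∑ x, auxDef μ κ d w x m = 0 := by
    cases m with
    | zero => rw [h0, hz]
    | succ m => rw [aux_cut_succ, hz, hz, sub_zero]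
  exact (Finset.sum_eq_zero_iff_of_nonneg fun x _ => hdef x m).mp hs x (Finset.mem_univ x)

theorem aux_comb [Fintype Z] [DecidableEq Z] (μ : Z → Z → ℝ) (κ : ℝ) (d π ρ : Z → ℕ → ℝ)
    (a b : ℝ) (x : Z) (m : ℕ) :
    auxDef μ κ d (fun x m => a * π x m + b * ρ x m) x m
      = a * auxDef μ κ d π x m + b * auxDef μ κ d ρ x m := by
  simp only [auxDef, add_mul, mul_assoc, Finset.sum_add_distrib, ← Finset.mul_sum]
  split_ifs <;> ring

theorem aux_unique [Fintype Z] [DecidableEq Z] [Nonempty Z] (μ : Z → Z → ℝ)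
    (hμ : ∀ z y : Z, z ≠ y → 0 < μ z y) (κ : ℝ) (hκ : 0 ≤ κ) (d π ρ : Z → ℕ → ℝ)
    (hd0 : ∀ x, d x 0 = 0) (hdp : ∀ x m, 0 < d x (m + 1))
    (hπ : ∀ x m, auxDef μ κ d π x m = 0) (hρ : ∀ x m, auxDef μ κ d ρ x m = 0)
    (hπ0 : ∀ x m, 0 ≤ π x m) (hρ0 : ∀ x m, 0 ≤ ρ x m)
    (hπs : Summable (fun p : Z × ℕ => π p.1 p.2)) (hρs : Summable (fun p : Z × ℕ => ρ p.1 p.2))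
    (hπ1 : (∑' p : Z × ℕ, π p.1 p.2) = 1) (hρ1 : (∑' p : Z × ℕ, ρ p.1 p.2) = 1) : π = ρ := by
  obtain ⟨x0⟩ := ‹Nonempty Z›
  have ht : ∀ f : Z → ℕ → ℝ, Summable (fun p : Z × ℕ => f p.1 p.2) → ∀ x,
      Filter.Tendsto (fun m => f x m) Filter.atTop (nhds 0) := by
    intro f hf x
    exact (hf.comp_injective (i := fun m : ℕ => (x, m))
      (fun a b h => by simpa using h)).tendsto_atTop_zero
  set a := ρ x0 0 with ha
  set b := π x0 0 with hb
  have ha0 : 0 ≤ a := hρ0 _ _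
  have hb0 : 0 ≤ b := hπ0 _ _
  have habs := aux_abs μ hμ κ hκ d (fun x m => a * π x m + (-b) * ρ x m)
    (fun x m => a * π x m + b * ρ x m) hd0 hdp
    (fun x m => by rw [aux_comb, hπ, hρ]; simp) (fun x m => by rw [aux_comb, hπ, hρ]; simp)
    (fun x m => by
      have h1 := mul_nonneg ha0 (hπ0 x m)
      have h2 := mul_nonneg hb0 (hρ0 x m)
      rw [abs_le]
      constructor <;> nlinarith)
    (fun x => by simpa using ((ht π hπs x).const_mul a).add ((ht ρ hρs x).const_mul b))
  have hz := aux_zero μ hμ κ d _ hd0 hdp (fun x m => abs_nonneg _) habs x0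
    (by simp only [← ha, ← hb]; rw [abs_eq_zero]; ring)
  have he : ∀ x m, a * π x m = b * ρ x m := by
    intro x m
    have := abs_eq_zero.mp (hz m x)
    linarith
  have hab : a = b := by
    have h1 : ∑' p : Z × ℕ, a * π p.1 p.2 = ∑' p : Z × ℕ, b * ρ p.1 p.2 :=
      tsum_congr fun p => he p.1 p.2
    rw [tsum_mul_left, tsum_mul_left, hπ1, hρ1] at h1
    linarith
  have hane : a ≠ 0 := by
    intro h
    have := aux_zero μ hμ κ d ρ hd0 hdp hρ0 hρ x0 h
    simp [this] at hρ1
  funext x m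
  have := he x m
  rw [← hab] at this
  exact mul_left_cancel₀ hane this

theorem aux_trunc [Fintype Z] [DecidableEq Z] [Nonempty Z] (μ : Z → Z → ℝ)
    (hμ : ∀ z y : Z, z ≠ y → 0 < μ z y) (κ : ℝ) (hκ : 0 ≤ κ) (d : Z → ℕ → ℝ)
    (hd0 : ∀ x, d x 0 = 0) (hdp : ∀ x m, 0 < d x (m + 1)) (N : ℕ) :
    ∃ π : Z → ℕ → ℝ, (∀ x m, 0 ≤ π x m) ∧ (∀ x m, N < m → π x m = 0) ∧
      HasSum (fun p : Z × ℕ => π p.1 p.2) 1 ∧ ∀ x m, m < N → auxDef μ κ d π x m = 0 := by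
  have hdn : ∀ x m, 0 ≤ d x m := by
    intro x m
    cases m with
    | zero => rw [hd0]
    | succ m => exact (hdp x m).le
  let q : Z × ℕ → Z × ℕ → ℝ := fun s t =>
    (if s.2 = t.2 then (if t.1 ≠ s.1 then μ s.1 t.1 else 0) else 0)
    + (if s.1 = t.1 then (if t.2 = s.2 + 1 then κ else 0) else 0)
    + (if s.1 = t.1 then (if s.2 = t.2 + 1 then d s.1 s.2 else 0) else 0)
  have hq : ∀ s t, 0 ≤ q s t := by
    intro s t
    refine add_nonneg (add_nonneg ?_ ?_) ?_
    · split_ifs with h1 h2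
      · exact (hμ _ _ (Ne.symm h2)).le
      · exact le_rfl
      · exact le_rfl
    · split_ifs <;> simp [hκ]
    · split_ifs <;> simp [hdn]
  obtain ⟨u, hu0, hu1, hu⟩ := aux_finite_stationary
    (S := Z × Fin (N + 1)) (fun s t => q (s.1, s.2) (t.1, t.2)) (fun _ _ => hq _ _)
  let π : Z → ℕ → ℝ := fun x m => if h : m < N + 1 then u (x, ⟨m, h⟩) else 0
  have hπu : ∀ x (j : Fin (N + 1)), u (x, j) = π x j := by
    intro x j
    simp only [π]
    rw [dif_pos j.2]
  have hbig : ∀ x m, N < m → π x m = 0 := by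
    intro x m hm
    simp only [π]
    rw [dif_neg (by omega)]
  refine ⟨π, ?_, hbig, ?_, ?_⟩
  · intro x m
    simp only [π]
    split_ifs
    · exact hu0 _
    · exact le_rfl
  · have h1 : ∑ p ∈ (Finset.univ : Finset Z) ×ˢ Finset.range (N + 1), π p.1 p.2 = 1 := by
      rw [Finset.sum_product, ← hu1, Fintype.sum_prod_type]
      refine Finset.sum_congr rfl fun x _ => ?_
      rw [← Fin.sum_univ_eq_sum_range (fun m => π x m)]
      exact Finset.sum_congr rfl fun j _ => (hπu x j).symm
    rw [← h1]
    refine hasSum_sum_of_ne_finset_zero fun p hp => hbig _ _ ?_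
    simp at hp
    omega
  · intro x m hm
    have hb := hu (x, ⟨m, by omega⟩)
    simp only [hπu, Fintype.sum_prod_type] at hb
    have e1 : ∀ y, ∑ j : Fin (N + 1), q (x, m) (y, j)
        = ∑ j ∈ Finset.range (N + 1), q (x, m) (y, j) := fun y =>
      Fin.sum_univ_eq_sum_range (fun j => q (x, m) (y, j)) (N + 1)
    have e2 : ∀ y, ∑ j : Fin (N + 1), π y j * q (y, j) (x, m)
        = ∑ j ∈ Finset.range (N + 1), π y j * q (y, j) (x, m) := fun y =>
      Fin.sum_univ_eq_sum_range (fun j => π y j * q (y, j) (x, m)) (N + 1)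
    simp only [e1, e2] at hb
    have m1 : m < N + 1 := by omega
    have m2 : m + 1 < N + 1 := by omega
    have o1 : ∑ y, ∑ j ∈ Finset.range (N + 1), q (x, m) (y, j)
        = (∑ y ∈ Finset.univ.filter (fun y => y ≠ x), μ x y) + κ + d x m := by
      simp only [q, Finset.sum_add_distrib]
      congr 1
      · congr 1
        · simp [Finset.sum_ite_eq, m1, Finset.sum_filter]
        · rw [Finset.sum_comm]
          simp [Finset.sum_ite_eq, m2]
      · rw [Finset.sum_comm]
        simp only [Finset.sum_ite_eq, Finset.mem_univ, if_true]
        cases m with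
        | zero => simp [hd0]
        | succ m => 
          simp [Finset.sum_ite_eq]
          intro; omega
    have o2 : ∑ y, ∑ j ∈ Finset.range (N + 1), π y j * q (y, j) (x, m)
        = (∑ z ∈ Finset.univ.filter (fun z => z ≠ x), π z m * μ z x)
        + κ * (if 1 ≤ m then π x (m - 1) else 0)
        + d x (m + 1) * π x (m + 1) := by
      simp only [q, mul_add, Finset.sum_add_distrib]
      congr 1
      · congr 1
        · simp [Finset.sum_ite_eq, m1, Finset.sum_filter, eq_comm]
        · rw [Finset.sum_comm]
          simp only [mul_ite, mul_zero, Finset.sum_ite_eq', Finset.mem_univ, if_true]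
          cases m with
          | zero => simp
          | succ m => 
            simp [Finset.sum_ite_eq, mul_comm]
            intro; omega
      · rw [Finset.sum_comm]
        simp [Finset.sum_ite_eq, m2, mul_comm]
    rw [o1, o2] at hb
    rw [auxDef, hb, sub_self]

theorem aux_exists [Fintype Z] [DecidableEq Z] [Nonempty Z] (μ : Z → Z → ℝ)
    (hμ : ∀ z y : Z, z ≠ y → 0 < μ z y) (κ : ℝ) (hκ : 0 ≤ κ) (d : Z → ℕ → ℝ)
    (hd0 : ∀ x, d x 0 = 0) (c : ℝ) (hc : 0 < c) (hdc : ∀ x (m : ℕ), c * m ≤ d x m) :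
    ∃ π : Z → ℕ → ℝ, (∀ x m, 0 ≤ π x m) ∧ Summable (fun p : Z × ℕ => π p.1 p.2) ∧
      (∑' p : Z × ℕ, π p.1 p.2) = 1 ∧ ∀ x m, auxDef μ κ d π x m = 0 := by
  have hdp : ∀ x m, 0 < d x (m + 1) := fun x m =>
    lt_of_lt_of_le (by positivity) (hdc x (m + 1))
  choose π hπ0 hπz hπs hπb using aux_trunc μ hμ κ hκ d hd0 hdp
  have hle1 : ∀ N m, ∑ x, π N x m ≤ 1 := by
    intro N m
    have h1 := sum_le_hasSum ((Finset.univ : Finset Z) ×ˢ {m})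
      (fun p _ => hπ0 N p.1 p.2) (hπs N)
    simpa [Finset.sum_product] using h1
  let b : ℕ → ℝ := fun m => (κ / c) ^ m / (Nat.factorial m)
  have hb : ∀ N m, ∑ x, π N x m ≤ b m := by
    intro N m
    induction m with
    | zero => simpa [b] using hle1 N 0
    | succ m ih =>
      have hbs : b (m + 1) = κ * b m / (c * (m + 1)) := by
        simp only [b, Nat.factorial_succ, pow_succ]
        push_cast
        field_simp
      have hbn : 0 ≤ b m := by positivity
      by_cases hm : m < N
      · have hcut := aux_cut_eq μ κ d (π N) hd0 m fun k hk x => hπb N x k (by omega)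
        have h2 : c * (m + 1) * ∑ x, π N x (m + 1) ≤ ∑ x, d x (m + 1) * π N x (m + 1) := by
          rw [Finset.mul_sum]
          refine Finset.sum_le_sum fun x _ => mul_le_mul_of_nonneg_right ?_ (hπ0 _ _ _)
          exact_mod_cast hdc x (m + 1)
        have h3 := mul_le_mul_of_nonneg_left ih hκ
        simp only [auxCut] at hcut
        rw [hbs, le_div_iff₀ (by positivity)]
        linarith
      · rw [Finset.sum_eq_zero fun x _ => hπz N x (m + 1) (by omega), hbs]
        positivity
  have hb' : ∀ N x m, π N x m ≤ b m := fun N x m =>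
    (Finset.single_le_sum (f := fun x => π N x m) (fun x _ => hπ0 N x m)
      (Finset.mem_univ x)).trans (hb N m)
  have hcomp : IsCompact (Set.univ.pi fun p : Z × ℕ => Set.Icc (0 : ℝ) (b p.2)) :=
    isCompact_univ_pi fun _ => isCompact_Icc
  obtain ⟨ρ, hρ, φ, hφ, hlim⟩ := hcomp.tendsto_subseq
    (x := fun N => fun p : Z × ℕ => π N p.1 p.2)
    (fun N p _ => ⟨hπ0 N p.1 p.2, hb' N p.1 p.2⟩)
  have hlim' : ∀ p : Z × ℕ, Filter.Tendsto (fun N => π (φ N) p.1 p.2) Filter.atTop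
      (nhds (ρ p)) := fun p => (tendsto_pi_nhds.mp hlim) p
  have hbsum : Summable (fun p : Z × ℕ => b p.2) := by
    have h1 : Summable b := Real.summable_pow_div_factorial _
    have hbn : ∀ m, 0 ≤ b m := fun m => by positivity
    rw [summable_prod_of_nonneg (fun p => hbn p.2)]
    exact ⟨fun _ => h1, (hasSum_fintype _).summable⟩
  have hρs : Summable ρ := Summable.of_nonneg_of_le (fun p => (hρ p trivial).1)
    (fun p => (hρ p trivial).2) hbsum
  have htsum := tendsto_tsum_of_dominated_convergence hbsum hlim'
    (Filter.Eventually.of_forall fun N p => by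
      rw [Real.norm_of_nonneg (hπ0 _ _ _)]; exact hb' _ _ _)
  refine ⟨fun x m => ρ (x, m), fun x m => (hρ (x, m) trivial).1, hρs, ?_, ?_⟩
  · simp only [fun N => (hπs (φ N)).tsum_eq] at htsum
    exact (tendsto_nhds_unique tendsto_const_nhds htsum).symm
  · intro x m
    have ht : Filter.Tendsto (fun N => auxDef μ κ d (π (φ N)) x m) Filter.atTop
        (nhds (auxDef μ κ d (fun x m => ρ (x, m)) x m)) := by
      simp only [auxDef]
      refine Filter.Tendsto.sub (Filter.Tendsto.add (Filter.Tendsto.add ?_ ?_) ?_) ?_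
      · exact tendsto_finsetSum _ fun z _ => (hlim' (z, m)).mul_const _
      · refine Filter.Tendsto.const_mul _ ?_
        split_ifs
        · exact hlim' (x, m - 1)
        · exact tendsto_const_nhds
      · exact (hlim' (x, m + 1)).const_mul _
      · exact (hlim' (x, m)).mul_const _
    refine tendsto_nhds_unique ht (tendsto_const_nhds.congr' ?_)
    filter_upwards [Filter.eventually_gt_atTop m] with N hN
    exact (hπb (φ N) x m (lt_of_lt_of_le hN (hφ.id_le N))).symm

/-- **Existence and uniqueness of the stationary distribution** (Lemma 1 of the
paper): for every Markovian strategy `ξ` and arrival rate `κ ≥ 0`, the balance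
equations of `MC(ξ,κ)` have exactly one probability solution. -/
theorem prob_solution_exists_unique (Z : Type) [Fintype Z] [DecidableEq Z] [Nonempty Z]
    (μ : Z → Z → ℝ) (hμ : ∀ z y : Z, z ≠ y → 0 < μ z y)
    (lam γ : ℝ) (hlam : 0 < lam) (hγ : γ ∈ Set.Ioo (0 : ℝ) 1)
    (ξ : Z → ℕ → ℝ) (hξ : IsStrategy ξ)
    (κ : ℝ) (hκ : 0 ≤ κ) :
    ∃! π : Z → ℕ → ℝ, IsProbSolution μ lam γ κ ξ π := by
  obtain ⟨hγ0, hγ1⟩ := hγ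
  let d : Z → ℕ → ℝ := fun x m => lam * m * (1 - γ * ξ x m)
  have hbal : ∀ π : Z → ℕ → ℝ, Balance μ lam γ κ ξ π ↔ ∀ x m, auxDef μ κ d π x m = 0 := by
    intro π
    refine forall_congr' fun x => forall_congr' fun m => ?_
    simp only [auxDef, d, sub_eq_zero]
    push_cast
    exact eq_comm
  have hd0 : ∀ x, d x 0 = 0 := fun x => by simp [d]
  have hc : 0 < lam * (1 - γ) := mul_pos hlam (by linarith)
  have hdc : ∀ x (m : ℕ), lam * (1 - γ) * m ≤ d x m := by
    intro x m
    have h1 : 1 - γ ≤ 1 - γ * ξ x m := by nlinarith [(hξ x m).2]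
    have h2 : 0 ≤ lam * m := by positivity
    have := mul_le_mul_of_nonneg_left h1 h2
    simp only [d]
    linarith
  have hdp : ∀ x m, 0 < d x (m + 1) := fun x m =>
    lt_of_lt_of_le (by positivity) (hdc x (m + 1))
  obtain ⟨π, h0, hs, h1, hb⟩ := aux_exists μ hμ κ hκ d hd0 _ hc hdc
  refine ⟨π, ⟨h0, hs, h1, (hbal π).mpr hb⟩, ?_⟩
  rintro ρ ⟨g0, gs, g1, gb⟩
  exact aux_unique μ hμ κ hκ d ρ π hd0 hdp ((hbal ρ).mp gb) hb g0 h0 gs hs g1 h1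
end

section
/- The map (ξ,κ) ↦ π(ξ,κ), sending a Markovian strategy ξ and arrival rate κ ∈ [β·λ·(1−γ), β·λ] to the unique probability solution π(ξ,κ) of the balance equations for (ξ,κ), is jointly and uniformly continuous: for every ε > 0 there exists δ > 0 such that for all Markovian strategies ξ₁, ξ₂ and all κ₁, κ₂ ∈ [β·λ·(1−γ), β·λ], if sup_{(z,n)∈S} |ξ₁(z,n) − ξ₂(z,n)| < δ and |κ₁ − κ₂| < δ, then ∑_{(z,n)∈S} |π(ξ₁,κ₁)(z,n) − π(ξ₂,κ₂)(z,n)| < ε. -/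
open scoped BigOperators

variable {Z : Type}

/-- Inflow minus outflow at a state. -/
noncomputable def resid [Fintype Z] [DecidableEq Z] (μ : Z → Z → ℝ) (lam γ κ : ℝ)
    (ξ : Z → ℕ → ℝ) (u : Z → ℕ → ℝ) (x : Z) (m : ℕ) : ℝ :=
  ((∑ z ∈ Finset.univ.filter (fun z => z ≠ x), u z m * μ z x)
        + κ * (if 1 ≤ m then u x (m - 1) else 0)
        + lam * (m + 1) * (1 - γ * ξ x (m + 1)) * u x (m + 1))
   - u x m * ((∑ y ∈ Finset.univ.filter (fun y => y ≠ x), μ x y) + κ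
        + lam * m * (1 - γ * ξ x m))

/-- Net downward flow through the cut between levels `m` and `m+1`. -/
noncomputable def cutE [Fintype Z] (lam γ κ : ℝ)
    (ξ : Z → ℕ → ℝ) (u : Z → ℕ → ℝ) (m : ℕ) : ℝ :=
  (∑ x : Z, lam * (m + 1) * (1 - γ * ξ x (m + 1)) * u x (m + 1)) - κ * ∑ x : Z, u x m

lemma mu_cancel [Fintype Z] [DecidableEq Z] (μ : Z → Z → ℝ) (v : Z → ℝ) :
    ∑ x : Z, (∑ z ∈ Finset.univ.filter (fun z => z ≠ x), v z * μ z x)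
      = ∑ x : Z, v x * (∑ y ∈ Finset.univ.filter (fun y => y ≠ x), μ x y) := by
  simp only [Finset.sum_filter, Finset.mul_sum]
  rw [Finset.sum_comm]
  refine Finset.sum_congr rfl fun x _ => Finset.sum_congr rfl fun y _ => ?_
  by_cases h : x = y
  · simp [h]
  · simp [h, Ne.symm h]

lemma resid_zero [Fintype Z] [DecidableEq Z] (μ : Z → Z → ℝ) (lam γ κ : ℝ)
    (ξ u : Z → ℕ → ℝ) : ∑ x : Z, resid μ lam γ κ ξ u x 0 = cutE lam γ κ ξ u 0 := by
  have h := mu_cancel μ (fun z => u z 0)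
  simp only [resid, cutE, mul_add, Finset.sum_add_distrib, Finset.sum_sub_distrib, h,
    Finset.mul_sum]
  simp [mul_comm κ]

lemma resid_succ [Fintype Z] [DecidableEq Z] (μ : Z → Z → ℝ) (lam γ κ : ℝ)
    (ξ u : Z → ℕ → ℝ) (m : ℕ) : ∑ x : Z, resid μ lam γ κ ξ u x (m + 1)
      = cutE lam γ κ ξ u (m + 1) - cutE lam γ κ ξ u m := by
  have h := mu_cancel μ (fun z => u z (m + 1))
  have e : ∀ x, resid μ lam γ κ ξ u x (m + 1)
      = (∑ z ∈ Finset.univ.filter (fun z => z ≠ x), u z (m + 1) * μ z x)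
        - u x (m + 1) * (∑ y ∈ Finset.univ.filter (fun y => y ≠ x), μ x y)
        + κ * u x m - κ * u x (m + 1)
        + lam * ((m + 1 : ℕ) + 1) * (1 - γ * ξ x (m + 1 + 1)) * u x (m + 1 + 1)
        - lam * (m + 1) * (1 - γ * ξ x (m + 1)) * u x (m + 1) := by
    intro x
    simp only [resid, Nat.le_add_left, if_true, Nat.add_sub_cancel]
    push_cast
    ring
  simp only [e, cutE, Finset.sum_add_distrib, Finset.sum_sub_distrib, h, Finset.mul_sum]
  ring

lemma balance_iff [Fintype Z] [DecidableEq Z] (μ : Z → Z → ℝ) (lam γ κ : ℝ)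
    (ξ u : Z → ℕ → ℝ) : Balance μ lam γ κ ξ u ↔ ∀ x m, resid μ lam γ κ ξ u x m = 0 := by
  unfold Balance resid
  refine forall_congr' fun x => forall_congr' fun m => ?_
  rw [sub_eq_zero, eq_comm]

lemma balance_cut [Fintype Z] [DecidableEq Z] {μ : Z → Z → ℝ} {lam γ κ : ℝ}
    {ξ u : Z → ℕ → ℝ} (hb : Balance μ lam γ κ ξ u) (m : ℕ) : cutE lam γ κ ξ u m = 0 := by
  rw [balance_iff] at hb
  induction m with
  | zero => rw [← resid_zero μ]; simp [hb]
  | succ m ih =>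
    have := resid_succ μ lam γ κ ξ u m
    simp [hb, ih] at this
    exact this.symm

/-- Uniform tail bound. -/
lemma prob_bound [Fintype Z] [DecidableEq Z] {μ : Z → Z → ℝ} {lam γ κ β : ℝ}
    (hlam : 0 < lam) (hγ : γ ∈ Set.Ioo (0 : ℝ) 1) (hβ : 0 < β) (hκ : κ ≤ β * lam)
    {ξ u : Z → ℕ → ℝ} (hξ : IsStrategy ξ) (hp : IsProbSolution μ lam γ κ ξ u) (x : Z) (m : ℕ) :
    u x m ≤ (β / (1 - γ)) ^ m / (m.factorial : ℝ) := by
  obtain ⟨h0, hs, h1, hb⟩ := hp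
  have hg : 0 < 1 - γ := by linarith [hγ.2]
  have key : ∀ m, ∑ x : Z, u x m ≤ (β / (1 - γ)) ^ m / (m.factorial : ℝ) := by
    intro m
    induction m with
    | zero =>
      simp only [pow_zero, Nat.factorial_zero, Nat.cast_one, div_one]
      rw [← h1]
      have := hs.sum_le_tsum (Finset.univ.map ⟨fun x : Z => (x, 0), fun a b h => by simpa using h⟩)
        (fun p _ => h0 p.1 p.2)
      rw [Finset.sum_map] at this
      exact this
    | succ m ih =>
      have hc := balance_cut hb m
      unfold cutE at hc
      have hm : (0 : ℝ) < m + 1 := by positivity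
      have h2 : lam * (m + 1) * (1 - γ) * ∑ x : Z, u x (m + 1)
          ≤ ∑ x : Z, lam * (m + 1) * (1 - γ * ξ x (m + 1)) * u x (m + 1) := by
        rw [Finset.mul_sum]
        refine Finset.sum_le_sum fun x _ => ?_
        refine mul_le_mul_of_nonneg_right ?_ (h0 _ _)
        refine mul_le_mul_of_nonneg_left ?_ (by positivity)
        nlinarith [(hξ x (m + 1)).2, hγ.1]
      have h3 : κ * ∑ x : Z, u x m ≤ β * lam * ((β / (1 - γ)) ^ m / (m.factorial : ℝ)) := by
        refine (mul_le_mul_of_nonneg_right hκ (Finset.sum_nonneg fun x _ => h0 x m)).trans ?_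
        exact mul_le_mul_of_nonneg_left ih (by positivity)
      have h4 : lam * (m + 1) * (1 - γ) * ∑ x : Z, u x (m + 1)
          ≤ lam * (m + 1) * (1 - γ) *
            ((β / (1 - γ)) ^ (m + 1) / ((m + 1).factorial : ℝ)) := by
        have : lam * (m + 1) * (1 - γ) *
            ((β / (1 - γ)) ^ (m + 1) / ((m + 1).factorial : ℝ))
            = β * lam * ((β / (1 - γ)) ^ m / (m.factorial : ℝ)) := by
          rw [Nat.factorial_succ, pow_succ]
          have : (m.factorial : ℝ) ≠ 0 := by positivity
          push_cast
          field_simp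
        rw [this]
        linarith
      exact le_of_mul_le_mul_left h4 (by positivity)
  exact (Finset.single_le_sum (f := fun x => u x m) (fun x _ => h0 x m) (Finset.mem_univ x)).trans
    (key m)

/-- Irreducibility: a nonnegative solution vanishing somewhere vanishes everywhere. -/
lemma zero_of_zero [Fintype Z] [DecidableEq Z] {μ : Z → Z → ℝ}
    (hμ : ∀ z y : Z, z ≠ y → 0 < μ z y) {lam γ κ : ℝ}
    (hlam : 0 < lam) (hγ : γ ∈ Set.Ioo (0 : ℝ) 1) (hκ : 0 < κ)
    {ξ u : Z → ℕ → ℝ} (hξ : IsStrategy ξ) (h0 : ∀ x m, 0 ≤ u x m)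
    (hb : Balance μ lam γ κ ξ u) {x₀ : Z} {m₀ : ℕ} (hz : u x₀ m₀ = 0) (x : Z) (m : ℕ) :
    u x m = 0 := by
  have hfac : ∀ x m, 0 < 1 - γ * ξ x m := fun x m => by
    nlinarith [(hξ x m).2, hγ.1, hγ.2]
  have step : ∀ x m, u x m = 0 → (∀ z, u z m = 0) ∧ (1 ≤ m → u x (m - 1) = 0) ∧
      u x (m + 1) = 0 := by
    intro x m h
    have e := hb x m
    rw [h, zero_mul] at e
    have a1 : 0 ≤ ∑ z ∈ Finset.univ.filter (fun z => z ≠ x), u z m * μ z x :=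
      Finset.sum_nonneg fun z hz => mul_nonneg (h0 _ _) (hμ _ _ (by simpa using hz)).le
    have a2 : 0 ≤ κ * (if 1 ≤ m then u x (m - 1) else 0) := by
      split_ifs
      · exact mul_nonneg hκ.le (h0 _ _)
      · simp
    have c3 : 0 < lam * (m + 1) * (1 - γ * ξ x (m + 1)) :=
      mul_pos (by positivity) (hfac _ _)
    have a3 : 0 ≤ lam * (m + 1) * (1 - γ * ξ x (m + 1)) * u x (m + 1) :=
      mul_nonneg c3.le (h0 _ _)
    have b1 : ∑ z ∈ Finset.univ.filter (fun z => z ≠ x), u z m * μ z x = 0 := by linarith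
    have b2 : κ * (if 1 ≤ m then u x (m - 1) else 0) = 0 := by linarith
    have b3 : lam * (m + 1) * (1 - γ * ξ x (m + 1)) * u x (m + 1) = 0 := by linarith
    refine ⟨fun z => ?_, fun hm => ?_, ?_⟩
    · by_cases hzx : z = x
      · rw [hzx, h]
      · rw [Finset.sum_eq_zero_iff_of_nonneg
          (fun z hz => mul_nonneg (h0 _ _) (hμ _ _ (by simpa using hz)).le)] at b1
        have := b1 z (by simpa using hzx)
        exact (mul_eq_zero.1 this).resolve_right (hμ _ _ hzx).ne'
    · rw [if_pos hm] at b2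
      exact (mul_eq_zero.1 b2).resolve_left hκ.ne'
    · exact (mul_eq_zero.1 b3).resolve_left c3.ne'
  have down : ∀ m, u x₀ m = 0 → u x₀ 0 = 0 := by
    intro m
    induction m with
    | zero => exact id
    | succ m ih => exact fun h => ih ((step x₀ (m + 1) h).2.1 (by omega))
  have up : ∀ m, u x₀ m = 0 := by
    intro m
    induction m with
    | zero => exact down _ hz
    | succ m ih => exact (step x₀ m ih).2.2
  exact (step x₀ m (up m)).1 x

/-- Uniqueness of the probability solution. -/
lemma prob_unique [Fintype Z] [DecidableEq Z] {μ : Z → Z → ℝ}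
    (hμ : ∀ z y : Z, z ≠ y → 0 < μ z y) {lam γ κ β : ℝ}
    (hlam : 0 < lam) (hγ : γ ∈ Set.Ioo (0 : ℝ) 1) (hβ : 0 < β) (hκ0 : 0 < κ) (hκ : κ ≤ β * lam)
    {ξ p q : Z → ℕ → ℝ} (hξ : IsStrategy ξ) (hp : IsProbSolution μ lam γ κ ξ p)
    (hq : IsProbSolution μ lam γ κ ξ q) (x : Z) (m : ℕ) : p x m = q x m := by
  have hfac : ∀ x m, 0 < 1 - γ * ξ x m := fun x m => by
    nlinarith [(hξ x m).2, hγ.1, hγ.2]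
  have hfac1 : ∀ x m, 1 - γ * ξ x m ≤ 1 := fun x m => by
    nlinarith [(hξ x m).1, hγ.1, hγ.2]
  set d : Z → ℕ → ℝ := fun x m => p x m - q x m with hd
  set u : Z → ℕ → ℝ := fun x m => |d x m| with hu
  have hdb : Balance μ lam γ κ ξ d := by
    intro x m
    have e1 := hp.2.2.2 x m
    have e2 := hq.2.2.2 x m
    have e3 : (if 1 ≤ m then d x (m - 1) else 0) = (if 1 ≤ m then p x (m - 1) else 0)
      - (if 1 ≤ m then q x (m - 1) else 0) := by split_ifs <;> simp [hd]
    rw [e3]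
    simp only [hd, sub_mul, Finset.sum_sub_distrib]
    linear_combination e1 - e2
  have hres : ∀ x m, 0 ≤ resid μ lam γ κ ξ u x m := by
    intro x m
    unfold resid
    rw [sub_nonneg]
    have hq0 : 0 ≤ (∑ y ∈ Finset.univ.filter (fun y => y ≠ x), μ x y) + κ
        + lam * m * (1 - γ * ξ x m) := by
      have := Finset.sum_nonneg (s := Finset.univ.filter (fun y => y ≠ x)) (f := fun y => μ x y)
        (fun y hy => (hμ x y (by simpa [eq_comm] using hy)).le)
      have := mul_nonneg (a := lam * m) (by positivity) (hfac x m).le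
      linarith
    have e := congrArg abs (hdb x m)
    rw [abs_mul, abs_of_nonneg hq0] at e
    change |d x m| * _ ≤ _
    rw [e]
    refine (abs_add_three _ _ _).trans (add_le_add (add_le_add ?_ ?_) ?_)
    · refine (Finset.abs_sum_le_sum_abs _ _).trans (Finset.sum_le_sum fun z hz => ?_)
      rw [abs_mul, abs_of_pos (hμ z x (by simpa using hz))]
    · rw [abs_mul, abs_of_pos hκ0]
      split_ifs <;> simp [hu]
    · rw [abs_mul, abs_of_pos (mul_pos (by positivity) (hfac _ _))]
  have hmono : Monotone (cutE lam γ κ ξ u) := by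
    refine monotone_nat_of_le_succ fun m => ?_
    have := resid_succ μ lam γ κ ξ u m
    have h2 := Finset.sum_nonneg (s := Finset.univ) (fun x _ => hres x (m + 1))
    linarith
  have hE0 : 0 ≤ cutE lam γ κ ξ u 0 := by
    rw [← resid_zero μ]
    exact Finset.sum_nonneg fun x _ => hres x 0
  set r := β / (1 - γ) with hr
  have hr0 : 0 < r := div_pos hβ (by linarith [hγ.2])
  have hub : ∀ x m, u x m ≤ 2 * (r ^ m / (m.factorial : ℝ)) := by
    intro x m
    have b1 := prob_bound hlam hγ hβ hκ hξ hp x m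
    have b2 := prob_bound hlam hγ hβ hκ hξ hq x m
    have := hp.1 x m
    have := hq.1 x m
    simp only [hu, hd]
    rw [abs_le]
    constructor <;> linarith
  have hEle : ∀ m, cutE lam γ κ ξ u m
      ≤ (Fintype.card Z) * (2 * lam * r) * (r ^ m / (m.factorial : ℝ)) := by
    intro m
    unfold cutE
    have h1 : 0 ≤ κ * ∑ x : Z, u x m :=
      mul_nonneg hκ0.le (Finset.sum_nonneg fun x _ => abs_nonneg _)
    have h2 : ∑ x : Z, lam * (m + 1) * (1 - γ * ξ x (m + 1)) * u x (m + 1)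
      ≤ ∑ x : Z, (2 * lam * r) * (r ^ m / (m.factorial : ℝ)) := by
      refine Finset.sum_le_sum fun x _ => ?_
      calc _ ≤ lam * (m + 1) * 1 * (2 * (r ^ (m + 1) / ((m + 1).factorial : ℝ))) := by
            refine mul_le_mul ?_ (hub _ _) (abs_nonneg _) (by positivity)
            exact mul_le_mul_of_nonneg_left (hfac1 _ _) (by positivity)
        _ = _ := by
            rw [Nat.factorial_succ, pow_succ]
            have : (m.factorial : ℝ) ≠ 0 := by positivity
            push_cast
            field_simp
    simp only [Finset.sum_const, nsmul_eq_mul, Finset.card_univ] at h2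
    linarith
  have hlim : Filter.Tendsto (fun m : ℕ => (Fintype.card Z) * (2 * lam * r) *
      (r ^ m / (m.factorial : ℝ))) Filter.atTop (nhds 0) := by
    simpa using (FloorSemiring.tendsto_pow_div_factorial_atTop r).const_mul
      ((Fintype.card Z) * (2 * lam * r))
  have hE : ∀ m, cutE lam γ κ ξ u m = 0 := by
    intro m
    refine le_antisymm ?_ (hE0.trans (hmono (Nat.zero_le m)))
    refine ge_of_tendsto hlim ?_
    filter_upwards [Filter.eventually_ge_atTop m] with k hk
    exact (hmono hk).trans (hEle k)
  have hub' : Balance μ lam γ κ ξ u := by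
    rw [balance_iff]
    intro x m
    have : ∑ x : Z, resid μ lam γ κ ξ u x m = 0 := by
      cases m with
      | zero => rw [resid_zero, hE]
      | succ m => rw [resid_succ, hE, hE, sub_zero]
    exact (Finset.sum_eq_zero_iff_of_nonneg (fun x _ => hres x m)).1 this x (Finset.mem_univ x)
  have hplus : Balance μ lam γ κ ξ (fun x m => u x m + d x m) := by
    intro x m
    have e1 := hub' x m
    have e2 := hdb x m
    have e3 : (if 1 ≤ m then u x (m - 1) + d x (m - 1) else 0)
      = (if 1 ≤ m then u x (m - 1) else 0) + (if 1 ≤ m then d x (m - 1) else 0) := by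
      split_ifs <;> simp
    simp only [e3, add_mul, Finset.sum_add_distrib]
    linear_combination e1 + e2
  have hsum : Summable (fun s : Z × ℕ => d s.1 s.2) := hp.2.1.sub hq.2.1
  have hts : ∑' s : Z × ℕ, d s.1 s.2 = 0 := by
    have := hp.2.1.tsum_sub hq.2.1
    rw [hp.2.2.1, hq.2.2.1, sub_self] at this
    exact this
  have hsign : (∀ x m, d x m ≤ 0) ∨ (∀ x m, 0 ≤ d x m) := by
    by_cases h : ∀ x m, 0 ≤ d x m
    · exact Or.inr h
    · left
      push Not at h
      obtain ⟨x₀, m₀, h⟩ := h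
      have hz : u x₀ m₀ + d x₀ m₀ = 0 := by
        simp only [hu]
        rw [abs_of_neg h]; ring
      intro x m
      have := zero_of_zero hμ hlam hγ hκ0 hξ
        (u := fun x m => u x m + d x m)
        (fun x m => by simp only [hu]; linarith [neg_abs_le (d x m)]) hplus hz x m
      have h2 : 0 ≤ u x m := abs_nonneg _
      linarith
  have hd0 : d x m = 0 := by
    rcases hsign with h | h
    · have h1 : ∑' s : Z × ℕ, -d s.1 s.2 = 0 := by rw [tsum_neg, hts, neg_zero]
      have h2 := (hasSum_zero_iff_of_nonneg (f := fun s : Z × ℕ => -d s.1 s.2)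
        (fun s => by simpa using h s.1 s.2)).1 (h1 ▸ hsum.neg.hasSum)
      simpa using congrFun h2 (x, m)
    · have h2 := (hasSum_zero_iff_of_nonneg (f := fun s : Z × ℕ => d s.1 s.2)
        (fun s => h s.1 s.2)).1 (hts ▸ hsum.hasSum)
      simpa using congrFun h2 (x, m)
  simpa [hd, sub_eq_zero] using hd0

lemma summable_dom [Fintype Z] (r : ℝ) :
    Summable (fun s : Z × ℕ => r ^ s.2 / (s.2.factorial : ℝ)) := by
  have h := Summable.mul_of_nonneg (f := fun _ : Z => (1 : ℝ))
    (g := fun n : ℕ => |r| ^ n / (n.factorial : ℝ)) (Summable.of_finite)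
    (Real.summable_pow_div_factorial |r|) (fun _ => zero_le_one) (fun n => by positivity)
  refine Summable.of_norm_bounded h fun s => ?_
  simp

/-- Limits of probability solutions are probability solutions. -/
lemma prob_limit [Fintype Z] [DecidableEq Z] {μ : Z → Z → ℝ} {lam γ β : ℝ}
    (hlam : 0 < lam) (hγ : γ ∈ Set.Ioo (0 : ℝ) 1) (hβ : 0 < β)
    (F : Filter ℕ) [F.NeBot] {ξs ps : ℕ → Z → ℕ → ℝ} {κs : ℕ → ℝ}
    {ξ p : Z → ℕ → ℝ} {κ : ℝ} (hκ : ∀ n, κs n ≤ β * lam) (hξ : ∀ n, IsStrategy (ξs n))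
    (hp : ∀ n, IsProbSolution μ lam γ (κs n) (ξs n) (ps n))
    (tξ : ∀ x m, Filter.Tendsto (fun n => ξs n x m) F (nhds (ξ x m)))
    (tp : ∀ x m, Filter.Tendsto (fun n => ps n x m) F (nhds (p x m)))
    (tκ : Filter.Tendsto κs F (nhds κ)) : IsProbSolution μ lam γ κ ξ p := by
  have hp0 : ∀ x m, 0 ≤ p x m := fun x m =>
    ge_of_tendsto (tp x m) (Filter.Eventually.of_forall fun n => (hp n).1 x m)
  have hpb : ∀ x m, p x m ≤ (β / (1 - γ)) ^ m / (m.factorial : ℝ) := fun x m =>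
    le_of_tendsto (tp x m)
      (Filter.Eventually.of_forall fun n => prob_bound hlam hγ hβ (hκ n) (hξ n) (hp n) x m)
  refine ⟨hp0, ?_, ?_, ?_⟩
  · exact Summable.of_nonneg_of_le (fun s => hp0 s.1 s.2) (fun s => hpb s.1 s.2)
      (summable_dom (β / (1 - γ)))
  · have := tendsto_tsum_of_dominated_convergence (𝓕 := F)
      (f := fun n (s : Z × ℕ) => ps n s.1 s.2) (g := fun s => p s.1 s.2)
      (summable_dom (β / (1 - γ))) (fun s => tp s.1 s.2)
      (Filter.Eventually.of_forall fun n s => by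
        rw [Real.norm_of_nonneg ((hp n).1 _ _)]
        exact prob_bound hlam hγ hβ (hκ n) (hξ n) (hp n) _ _)
    simp only [(hp _).2.2.1] at this
    exact tendsto_nhds_unique this tendsto_const_nhds
  · intro x m
    have fac : ∀ m, Filter.Tendsto (fun n => 1 - γ * ξs n x m) F (nhds (1 - γ * ξ x m)) :=
      fun m => tendsto_const_nhds.sub ((tξ x m).const_mul γ)
    have t1 := (tp x m).mul
      ((tκ.const_add (∑ y ∈ Finset.univ.filter (fun y => y ≠ x), μ x y)).add
        ((fac m).const_mul (lam * m)))
    have ti : Filter.Tendsto (fun n => if 1 ≤ m then ps n x (m - 1) else 0) F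
        (nhds (if 1 ≤ m then p x (m - 1) else 0)) := by
      split_ifs
      · exact tp _ _
      · exact tendsto_const_nhds
    have t2 := ((tendsto_finsetSum (Finset.univ.filter (fun z => z ≠ x))
      (fun z _ => (tp z m).mul_const (μ z x))).add (tκ.mul ti)).add
        (((fac (m + 1)).const_mul (lam * (m + 1))).mul (tp x (m + 1)))
    refine tendsto_nhds_unique t1 (t2.congr fun n => ?_)
    exact ((hp n).2.2.2 x m).symm

lemma exists_ultra_lim (F : Ultrafilter ℕ) {a b : ℝ} (f : ℕ → ℝ) (h : ∀ n, f n ∈ Set.Icc a b) :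
    ∃ l ∈ Set.Icc a b, Filter.Tendsto f F (nhds l) := by
  have := (isCompact_Icc (a := a) (b := b)).ultrafilter_le_nhds (F.map f) (by
    rw [Filter.le_principal_iff]
    exact Filter.mem_map.2 (Filter.Eventually.of_forall h))
  exact this

/-- **Joint uniform continuity of the stationary distribution** (Lemma 2 of the
paper): the map `(ξ, κ) ↦ π(ξ, κ)` is jointly and uniformly continuous from
(strategies with the sup-norm) × `[βλ(1-γ), βλ]` to probability distributions
with the ℓ¹-norm. -/
theorem pi_uniformly_continuous (Z : Type) [Fintype Z] [DecidableEq Z] [Nonempty Z]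
    (μ : Z → Z → ℝ) (hμ : ∀ z y : Z, z ≠ y → 0 < μ z y)
    (lam γ β : ℝ) (hlam : 0 < lam) (hγ : γ ∈ Set.Ioo (0 : ℝ) 1) (hβ : 0 < β) :
    ∀ ε : ℝ, 0 < ε → ∃ δ : ℝ, 0 < δ ∧
      ∀ (ξ₁ ξ₂ : Z → ℕ → ℝ) (κ₁ κ₂ : ℝ) (π₁ π₂ : Z → ℕ → ℝ),
        IsStrategy ξ₁ → IsStrategy ξ₂ →
        κ₁ ∈ Set.Icc (β * lam * (1 - γ)) (β * lam) →
        κ₂ ∈ Set.Icc (β * lam * (1 - γ)) (β * lam) →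
        IsProbSolution μ lam γ κ₁ ξ₁ π₁ →
        IsProbSolution μ lam γ κ₂ ξ₂ π₂ →
        (⨆ p : Z × ℕ, |ξ₁ p.1 p.2 - ξ₂ p.1 p.2|) < δ →
        |κ₁ - κ₂| < δ →
        (∑' p : Z × ℕ, |π₁ p.1 p.2 - π₂ p.1 p.2|) < ε := by
  intro ε hε
  by_contra hcon
  push Not at hcon
  have hδ : ∀ n : ℕ, (0 : ℝ) < 1 / ((n : ℝ) + 1) := fun n => by positivity
  choose ξ₁ ξ₂ κ₁ κ₂ p₁ p₂ hξ₁ hξ₂ hκ₁ hκ₂ hp₁ hp₂ hsup hκd hge using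
    fun n : ℕ => hcon (1 / ((n : ℝ) + 1)) (hδ n)
  let F : Ultrafilter ℕ := Filter.hyperfilter ℕ
  have hF : (F : Filter ℕ) ≤ Filter.atTop := by
    have := Filter.hyperfilter_le_cofinite (α := ℕ)
    rwa [Nat.cofinite_eq_atTop] at this
  have tδ : Filter.Tendsto (fun n : ℕ => 1 / ((n : ℝ) + 1)) F (nhds 0) :=
    (tendsto_one_div_add_atTop_nhds_zero_nat (𝕜 := ℝ)).mono_left hF
  have le1 : ∀ (κ : ℝ) (ξ p : Z → ℕ → ℝ), IsProbSolution μ lam γ κ ξ p → ∀ x m, p x m ≤ 1 := by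
    intro κ ξ p hp x m
    rw [← hp.2.2.1]
    exact hp.2.1.le_tsum (x, m) (fun s _ => hp.1 s.1 s.2)
  choose ξ hξI tξ using fun x m => exists_ultra_lim F (fun n => ξ₁ n x m)
    (fun n => ⟨(hξ₁ n x m).1, (hξ₁ n x m).2⟩)
  choose p _ tp using fun x m => exists_ultra_lim F (fun n => p₁ n x m)
    (fun n => ⟨(hp₁ n).1 x m, le1 _ _ _ (hp₁ n) x m⟩)
  choose q _ tq using fun x m => exists_ultra_lim F (fun n => p₂ n x m)
    (fun n => ⟨(hp₂ n).1 x m, le1 _ _ _ (hp₂ n) x m⟩)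
  obtain ⟨κ, hκI, tκ⟩ := exists_ultra_lim F κ₁ hκ₁
  have tκ₂ : Filter.Tendsto κ₂ F (nhds κ) := by
    have h : Filter.Tendsto (fun n => κ₁ n - κ₂ n) F (nhds 0) :=
      squeeze_zero_norm (fun n => (hκd n).le) tδ
    simpa using tκ.sub h
  have tξ₂ : ∀ x m, Filter.Tendsto (fun n => ξ₂ n x m) F (nhds (ξ x m)) := by
    intro x m
    have h : Filter.Tendsto (fun n => ξ₁ n x m - ξ₂ n x m) F (nhds 0) := by
      refine squeeze_zero_norm (fun n => ?_) tδ
      refine le_trans ?_ (hsup n).le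
      refine le_ciSup (f := fun s : Z × ℕ => |ξ₁ n s.1 s.2 - ξ₂ n s.1 s.2|) ⟨1, ?_⟩ (x, m)
      rintro _ ⟨s, rfl⟩
      have a := hξ₁ n s.1 s.2
      have b := hξ₂ n s.1 s.2
      exact abs_le.2 ⟨by linarith [a.1, b.2], by linarith [a.2, b.1]⟩
    simpa using (tξ x m).sub h
  have hp := prob_limit hlam hγ hβ F (fun n => (hκ₁ n).2) hξ₁ hp₁ tξ tp tκ
  have hq := prob_limit hlam hγ hβ F (fun n => (hκ₂ n).2) hξ₂ hp₂ tξ₂ tq tκ₂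
  have hκ0 : 0 < κ := lt_of_lt_of_le
    (mul_pos (mul_pos hβ hlam) (by linarith [hγ.2])) hκI.1
  have hpq := prob_unique hμ hlam hγ hβ hκ0 hκI.2 (fun x m => hξI x m) hp hq
  have hfin := tendsto_tsum_of_dominated_convergence (𝓕 := (F : Filter ℕ))
    (f := fun n (s : Z × ℕ) => |p₁ n s.1 s.2 - p₂ n s.1 s.2|) (g := fun _ => (0 : ℝ))
    ((summable_dom (Z := Z) (β / (1 - γ))).mul_left 2)
    (fun s => by
      have := ((tp s.1 s.2).sub (tq s.1 s.2)).abs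
      simpa [hpq s.1 s.2] using this)
    (Filter.Eventually.of_forall fun n s => by
      have b1 := prob_bound hlam hγ hβ (hκ₁ n).2 (hξ₁ n) (hp₁ n) s.1 s.2
      have b2 := prob_bound hlam hγ hβ (hκ₂ n).2 (hξ₂ n) (hp₂ n) s.1 s.2
      have a1 := (hp₁ n).1 s.1 s.2
      have a2 := (hp₂ n).1 s.1 s.2
      rw [Real.norm_eq_abs, abs_abs, abs_le]
      constructor <;> linarith)
  rw [tsum_zero] at hfin
  have := ge_of_tendsto hfin (Filter.Eventually.of_forall hge)
  linarith
end
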